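/- arXiv:0804.4764 — 13 statements merged into one kernel-verified Lean document; each statement's English description precedes it below -/
import Mathlib

section
/- Let δ₁, δ₂ form a regular P-configuration in I = [-1,1]. If f : I → ℝ is continuously differentiable and satisfies f(t) = f(δ₁(t)) + f(δ₂(t)) for all t ∈ I, then there exists c ∈ ℝ such that f(z) = c·z for all z ∈ I. -/
open Set

/-- The interval `I = [-1, 1]`. -/
def Iseg : Set ℝ := Set.Icc (-1) 1

/-- `δ₁, δ₂ : I → I` (with derivative functions `d₁, d₂` on `I`) form a *regular
P-configuration* in `I = [-1,1]`: they are `C¹`, `d₁ + d₂ = 1`, both derivatives are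
strictly positive, and the endpoint conditions hold. -/
structure RegPConfig (δ₁ δ₂ d₁ d₂ : ℝ → ℝ) : Prop where
  maps₁ : MapsTo δ₁ Iseg Iseg
  maps₂ : MapsTo δ₂ Iseg Iseg
  hasDeriv₁ : ∀ t ∈ Iseg, HasDerivWithinAt δ₁ (d₁ t) Iseg t
  hasDeriv₂ : ∀ t ∈ Iseg, HasDerivWithinAt δ₂ (d₂ t) Iseg t
  contDeriv₁ : ContinuousOn d₁ Iseg
  contDeriv₂ : ContinuousOn d₂ Iseg
  derivSum : ∀ t ∈ Iseg, d₁ t + d₂ t = 1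
  derivPos₁ : ∀ t ∈ Iseg, 0 < d₁ t
  derivPos₂ : ∀ t ∈ Iseg, 0 < d₂ t
  fix₂ : δ₂ (-1) = -1
  mid₂ : δ₂ 1 = 0
  mid₁ : δ₁ (-1) = 0
  fix₁ : δ₁ 1 = 1

/-- A function with vanishing derivative on `I` is constant on `I`. -/
lemma eq_of_hasDerivWithinAt_zero {h : ℝ → ℝ}
    (hh : ∀ t ∈ Iseg, HasDerivWithinAt h 0 Iseg t) {s t : ℝ} (hs : s ∈ Iseg) (ht : t ∈ Iseg) :
    h t = h s := by
  have := (convex_Icc (-1 : ℝ) 1).norm_image_sub_le_of_norm_hasDerivWithin_le (f := h)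
    (f' := fun _ => 0) (C := 0) hh (by simp) hs ht
  rw [zero_mul] at this
  exact sub_eq_zero.mp (norm_le_zero_iff.mp this)

lemma one_mem_Iseg : (1 : ℝ) ∈ Iseg := by
  constructor <;> norm_num

lemma zero_mem_Iseg : (0 : ℝ) ∈ Iseg := by
  constructor <;> norm_num

namespace RegPConfig

variable {δ₁ δ₂ d₁ d₂ : ℝ → ℝ}

lemma add_eq (hP : RegPConfig δ₁ δ₂ d₁ d₂) {t : ℝ} (ht : t ∈ Iseg) : δ₁ t + δ₂ t = t := by
  have h := eq_of_hasDerivWithinAt_zero (h := fun t => δ₁ t + δ₂ t - t) (fun t ht => by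
    have := ((hP.hasDeriv₁ t ht).add (hP.hasDeriv₂ t ht)).sub (hasDerivWithinAt_id t Iseg)
    rw [hP.derivSum t ht, sub_self] at this
    exact this) one_mem_Iseg ht
  simp only [hP.fix₁, hP.mid₂] at h
  linarith

lemma strictMonoOn₂ (hP : RegPConfig δ₁ δ₂ d₁ d₂) : StrictMonoOn δ₂ Iseg :=
  strictMonoOn_of_hasDerivWithinAt_pos (convex_Icc (-1 : ℝ) 1)
    (fun t ht => (hP.hasDeriv₂ t ht).continuousWithinAt)
    (fun t ht => (hP.hasDeriv₂ t (interior_subset ht)).mono interior_subset)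
    (fun t ht => hP.derivPos₂ t (interior_subset ht))

/-- Maximum principle: a continuous solution of the differentiated equation attains its
maximum at `1`. -/
lemma le_apply_one (hP : RegPConfig δ₁ δ₂ d₁ d₂) {g : ℝ → ℝ} (hg : ContinuousOn g Iseg)
    (heq : ∀ t ∈ Iseg, g t = d₁ t * g (δ₁ t) + d₂ t * g (δ₂ t)) {t : ℝ} (ht : t ∈ Iseg) :
    g t ≤ g 1 := by
  have hI : IsCompact Iseg := isCompact_Icc
  obtain ⟨m, hm, hmax⟩ := hI.exists_isMaxOn ⟨1, one_mem_Iseg⟩ hg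
  have hK : IsCompact (Iseg ∩ g ⁻¹' {g m}) :=
    hI.of_isClosed_subset (hg.preimage_isClosed_of_isClosed isClosed_Icc isClosed_singleton)
      inter_subset_left
  obtain ⟨s, ⟨hs, hsm⟩, hgreatest⟩ := hK.exists_isGreatest ⟨m, hm, rfl⟩
  have hsm : g s = g m := hsm
  have h₁ : g (δ₁ s) ≤ g m := hmax (hP.maps₁ hs)
  have h₂ : g (δ₂ s) ≤ g m := hmax (hP.maps₂ hs)
  have hδ : g (δ₁ s) = g m := by
    have e := heq s hs
    have hd := hP.derivSum s hs
    have p₁ := hP.derivPos₁ s hs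
    have p₂ := hP.derivPos₂ s hs
    have e' : d₁ s * (g m - g (δ₁ s)) + d₂ s * (g m - g (δ₂ s)) = 0 := by
      linear_combination g m * hd - hsm + e
    have q₂ := mul_nonneg p₂.le (sub_nonneg.mpr h₂)
    refine le_antisymm h₁ (le_of_not_gt fun hlt => ?_)
    have q₁ := mul_pos p₁ (sub_pos.mpr hlt)
    linarith
  have hle : δ₁ s ≤ s := hgreatest ⟨hP.maps₁ hs, hδ⟩
  have hs1 : s = 1 := by
    refine le_antisymm hs.2 (le_of_not_gt fun hlt => ?_)
    have h := hP.strictMonoOn₂ hs one_mem_Iseg hlt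
    rw [hP.mid₂] at h
    linarith [hP.add_eq hs]
  rw [← hs1, hsm]
  exact hmax ht

end RegPConfig

/-- **Paneah's theorem.** If `δ₁, δ₂` form a regular P-configuration in `I = [-1,1]` and
`f` is `C¹` on `I` and satisfies `f(t) = f(δ₁ t) + f(δ₂ t)` on `I`, then `f` is linear. -/
theorem c1_solutions_are_linear (δ₁ δ₂ d₁ d₂ f : ℝ → ℝ)
    (hP : RegPConfig δ₁ δ₂ d₁ d₂)
    (hf : ContDiffOn ℝ 1 f Iseg)
    (heq : ∀ t ∈ Iseg, f t = f (δ₁ t) + f (δ₂ t)) :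
    ∃ c : ℝ, ∀ z ∈ Iseg, f z = c * z := by
  have hu : UniqueDiffOn ℝ Iseg := uniqueDiffOn_Icc (by norm_num)
  set g := derivWithin f Iseg
  have hg : ContinuousOn g Iseg := hf.continuousOn_derivWithin hu le_rfl
  have hd : ∀ t ∈ Iseg, HasDerivWithinAt f (g t) Iseg t := fun t ht =>
    (hf.differentiableOn one_ne_zero t ht).hasDerivWithinAt
  have hgeq : ∀ t ∈ Iseg, g t = d₁ t * g (δ₁ t) + d₂ t * g (δ₂ t) := fun t ht => by
    have h := ((hd _ (hP.maps₁ ht)).comp t (hP.hasDeriv₁ t ht) hP.maps₁).add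
      ((hd _ (hP.maps₂ ht)).comp t (hP.hasDeriv₂ t ht) hP.maps₂)
    rw [(hu t ht).eq_deriv _ (hd t ht) (h.congr heq (heq t ht))]
    ring
  have hconst : ∀ t ∈ Iseg, g t = g 1 := fun t ht => by
    have h := hP.le_apply_one (g := fun t => -g t) hg.neg
      (fun t ht => by simp only [hgeq t ht]; ring) ht
    exact le_antisymm (hP.le_apply_one hg hgeq ht) (neg_le_neg_iff.mp h)
  have hf0 : f 0 = 0 := by
    have h := heq 1 one_mem_Iseg
    rw [hP.fix₁, hP.mid₂] at h
    linarith
  refine ⟨g 1, fun z hz => ?_⟩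
  have h := eq_of_hasDerivWithinAt_zero (h := fun z => f z - g 1 * z) (fun t ht => by
    have := (hd t ht).sub ((hasDerivWithinAt_id t Iseg).const_mul (g 1))
    rw [hconst t ht, mul_one, sub_self] at this
    exact this) zero_mem_Iseg hz
  simp only [hf0, mul_zero, sub_zero] at h
  linarith
end

section
/- If f : [-1,1] → ℝ is continuously differentiable and satisfies f(t) = f((t+1)/2) + f((t-1)/2) for all t ∈ [-1,1], then there exists c ∈ ℝ such that f(z) = c·z for all z ∈ [-1,1]. -/
open Set

open Filter Topology

theorem mapsTo_add_one_div_two : MapsTo (fun t : ℝ => (t + 1) / 2) Iseg Iseg := by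
  rintro t ⟨h1, h2⟩
  constructor <;> linarith

theorem mapsTo_sub_one_div_two : MapsTo (fun t : ℝ => (t - 1) / 2) Iseg Iseg := by
  rintro t ⟨h1, h2⟩
  constructor <;> linarith

/-- A continuous function on `[-1, 1]` equal to the mean of its values at `(t + 1) / 2` and
`(t - 1) / 2` attains its maximum at `1`. -/
theorem le_apply_one_of_eq_mean {g : ℝ → ℝ} (hg : ContinuousOn g Iseg)
    (hmean : ∀ t ∈ Iseg, g t = (g ((t + 1) / 2) + g ((t - 1) / 2)) / 2) :
    ∀ x ∈ Iseg, g x ≤ g 1 := by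
  obtain ⟨a, ha, hmax⟩ : ∃ a ∈ Iseg, IsMaxOn g Iseg a :=
    isCompact_Icc.exists_isMaxOn ⟨0, by norm_num⟩ hg
  have step : ∀ t ∈ Iseg, g t = g a → g ((t + 1) / 2) = g a := by
    intro t ht hta
    have h1 : g ((t + 1) / 2) ≤ g a := hmax (mapsTo_add_one_div_two ht)
    have h2 : g ((t - 1) / 2) ≤ g a := hmax (mapsTo_sub_one_div_two ht)
    have h3 := hmean t ht
    linarith
  have orbit : ∀ n : ℕ, 1 - (1 - a) * (1 / 2) ^ n ∈ Iseg ∧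
      g (1 - (1 - a) * (1 / 2) ^ n) = g a := by
    intro n
    induction n with
    | zero => simpa using ha
    | succ n ih =>
      have h : 1 - (1 - a) * (1 / 2) ^ (n + 1) = (1 - (1 - a) * (1 / 2) ^ n + 1) / 2 := by
        ring
      rw [h]
      exact ⟨mapsTo_add_one_div_two ih.1, step _ ih.1 ih.2⟩
  have hlim : Tendsto (fun n : ℕ => 1 - (1 - a) * (1 / 2 : ℝ) ^ n) atTop (𝓝 1) := by
    have h := tendsto_pow_atTop_nhds_zero_of_lt_one (r := (1 / 2 : ℝ)) (by norm_num) (by norm_num)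
    simpa using (h.const_mul (1 - a)).const_sub 1
  have hone : (1 : ℝ) ∈ Iseg := ⟨by norm_num, le_rfl⟩
  have hglim := (hg 1 hone).tendsto.comp
    (tendsto_nhdsWithin_iff.2 ⟨hlim, .of_forall fun n => (orbit n).1⟩)
  have hga : g 1 = g a :=
    tendsto_nhds_unique hglim (tendsto_const_nhds.congr fun n => (orbit n).2.symm)
  intro x hx
  rw [hga]
  exact hmax hx

/-- The derivative of a solution is the mean of its values at `(t + 1) / 2` and `(t - 1) / 2`. -/
theorem derivWithin_eq_mean {f : ℝ → ℝ} (hf : DifferentiableOn ℝ f Iseg)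
    (heq : ∀ t ∈ Iseg, f t = f ((t + 1) / 2) + f ((t - 1) / 2)) :
    ∀ t ∈ Iseg, derivWithin f Iseg t =
      (derivWithin f Iseg ((t + 1) / 2) + derivWithin f Iseg ((t - 1) / 2)) / 2 := by
  intro t ht
  have h1 := (hf _ (mapsTo_add_one_div_two ht)).hasDerivWithinAt.comp t
    (((hasDerivAt_id t).add_const 1).div_const 2).hasDerivWithinAt mapsTo_add_one_div_two
  have h2 := (hf _ (mapsTo_sub_one_div_two ht)).hasDerivWithinAt.comp t
    (((hasDerivAt_id t).sub_const 1).div_const 2).hasDerivWithinAt mapsTo_sub_one_div_two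
  have h := ((h1.add h2).congr heq (heq t ht)).derivWithin
    (uniqueDiffOn_Icc (by norm_num) t ht)
  rw [h]
  ring

/-- If `f` is `C¹` on `[-1,1]` and satisfies `f(t) = f((t+1)/2) + f((t-1)/2)` there, then
`f` is linear. -/
theorem c1_solutions_are_linear_special (f : ℝ → ℝ)
    (hf : ContDiffOn ℝ 1 f Iseg)
    (heq : ∀ t ∈ Iseg, f t = f ((t + 1) / 2) + f ((t - 1) / 2)) :
    ∃ c : ℝ, ∀ z ∈ Iseg, f z = c * z := by
  have hu : UniqueDiffOn ℝ Iseg := uniqueDiffOn_Icc (by norm_num)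
  have hd : DifferentiableOn ℝ f Iseg := hf.differentiableOn one_ne_zero
  have hcont := hf.continuousOn_derivWithin hu le_rfl
  have hmean := derivWithin_eq_mean hd heq
  set c := derivWithin f Iseg 1
  have hconst : ∀ x ∈ Iseg, derivWithin f Iseg x = c := by
    intro x hx
    refine le_antisymm (le_apply_one_of_eq_mean hcont hmean x hx) ?_
    refine neg_le_neg_iff.1 (le_apply_one_of_eq_mean hcont.neg (fun t ht => ?_) x hx)
    simp only [Pi.neg_apply]
    rw [hmean t ht]
    ring
  have hderiv : ∀ x ∈ Iseg, HasDerivWithinAt (fun y => f y - c * y) 0 Iseg x := by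
    intro x hx
    have h := (hd x hx).hasDerivWithinAt
    rw [hconst x hx] at h
    have h' := h.sub ((hasDerivWithinAt_id x Iseg).const_mul c)
    rw [mul_one, sub_self] at h'
    exact h'
  have haff : ∀ x ∈ Iseg, f x - c * x = f (-1) - c * (-1) :=
    constant_of_derivWithin_zero (fun x hx => (hderiv x hx).differentiableWithinAt)
      fun x hx => (hderiv x (Ico_subset_Icc_self hx)).derivWithin
        (hu x (Ico_subset_Icc_self hx))
  have hzero : (0 : ℝ) ∈ Iseg := by constructor <;> norm_num
  refine ⟨c, fun z hz => ?_⟩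
  have e0 := heq 0 hzero
  have h0 := haff 0 hzero
  have h1 := haff _ (mapsTo_add_one_div_two hzero)
  have h2 := haff _ (mapsTo_sub_one_div_two hzero)
  have h3 := haff z hz
  linarith
end

section
/- Let (I, δ₁, δ₂) and (I, σ₁, σ₂) be two regular P-configurations and let h : I → I be any function satisfying h(δᵢ(t)) = σᵢ(h(t)) for i = 1,2 and all t ∈ I. Then necessarily h(-1) = -1, h(0) = 0, and h(1) = 1. -/
open Set

namespace RegPConfig

variable {δ₁ δ₂ d₁ d₂ : ℝ → ℝ}

theorem add_eq_self (H : RegPConfig δ₁ δ₂ d₁ d₂) {t : ℝ} (ht : t ∈ Iseg) :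
    δ₁ t + δ₂ t = t := by
  have hl : (-1 : ℝ) ∈ Iseg := by constructor <;> norm_num
  have hderiv : ∀ x ∈ Iseg,
      HasDerivWithinAt (fun y => δ₁ y + δ₂ y - y) (d₁ x + d₂ x - 1) Iseg x := fun x hx =>
    ((H.hasDeriv₁ x hx).add (H.hasDeriv₂ x hx)).sub (hasDerivWithinAt_id x Iseg)
  have hbound : ∀ x ∈ Iseg, ‖d₁ x + d₂ x - 1‖ ≤ 0 := fun x hx => by
    simp [H.derivSum x hx]
  have hsub := (convex_Icc (-1 : ℝ) 1).norm_image_sub_le_of_norm_hasDerivWithin_le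
    hderiv hbound hl ht
  rw [zero_mul, norm_le_zero_iff, H.mid₁, H.fix₂] at hsub
  linarith

theorem strictMonoOn_left (H : RegPConfig δ₁ δ₂ d₁ d₂) : StrictMonoOn δ₁ Iseg :=
  strictMonoOn_of_hasDerivWithinAt_pos (convex_Icc (-1) 1)
    (fun t ht => (H.hasDeriv₁ t ht).continuousWithinAt)
    (fun t ht => (H.hasDeriv₁ t (interior_subset ht)).mono interior_subset)
    (fun t ht => H.derivPos₁ t (interior_subset ht))

theorem strictMonoOn_right (H : RegPConfig δ₁ δ₂ d₁ d₂) : StrictMonoOn δ₂ Iseg :=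
  strictMonoOn_of_hasDerivWithinAt_pos (convex_Icc (-1) 1)
    (fun t ht => (H.hasDeriv₂ t ht).continuousWithinAt)
    (fun t ht => (H.hasDeriv₂ t (interior_subset ht)).mono interior_subset)
    (fun t ht => H.derivPos₂ t (interior_subset ht))

theorem eq_one_of_left_fixed (H : RegPConfig δ₁ δ₂ d₁ d₂) {t : ℝ} (ht : t ∈ Iseg)
    (hfix : δ₁ t = t) : t = 1 := by
  refine H.strictMonoOn_right.injOn ht (by constructor <;> norm_num) ?_
  linarith [H.add_eq_self ht, H.mid₂]

theorem eq_neg_one_of_right_fixed (H : RegPConfig δ₁ δ₂ d₁ d₂) {t : ℝ} (ht : t ∈ Iseg)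
    (hfix : δ₂ t = t) : t = -1 := by
  refine H.strictMonoOn_left.injOn ht (by constructor <;> norm_num) ?_
  linarith [H.add_eq_self ht, H.mid₁]

end RegPConfig

/-- Any map `h : I → I` intertwining two regular P-configurations must fix `-1`, `0`, `1`. -/
theorem conjugation_fixes_endpoints (δ₁ δ₂ d₁ d₂ σ₁ σ₂ e₁ e₂ h : ℝ → ℝ)
    (hδ : RegPConfig δ₁ δ₂ d₁ d₂) (hσ : RegPConfig σ₁ σ₂ e₁ e₂)
    (hmaps : MapsTo h Iseg Iseg)
    (hconj₁ : ∀ t ∈ Iseg, h (δ₁ t) = σ₁ (h t))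
    (hconj₂ : ∀ t ∈ Iseg, h (δ₂ t) = σ₂ (h t)) :
    h (-1) = -1 ∧ h 0 = 0 ∧ h 1 = 1 := by
  have hl : (-1 : ℝ) ∈ Iseg := by constructor <;> norm_num
  have hr : (1 : ℝ) ∈ Iseg := by constructor <;> norm_num
  have hright : h 1 = 1 := hσ.eq_one_of_left_fixed (hmaps hr) (by rw [← hconj₁ 1 hr, hδ.fix₁])
  refine ⟨hσ.eq_neg_one_of_right_fixed (hmaps hl) (by rw [← hconj₂ _ hl, hδ.fix₂]), ?_, hright⟩
  rw [← hδ.mid₂, hconj₂ 1 hr, hright, hσ.mid₂, hδ.mid₂]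
end

section
/- Let (I, δ₁, δ₂) and (I, σ₁, σ₂) be two regular quasi P-configurations, and assume that σ₁'(t) < 1 and σ₂'(t) < 1 for all t ∈ I. Then there exists a unique continuous map h : I → I such that h(-1) = -1, h(0) = 0, h(1) = 1, and h(δᵢ(t)) = σᵢ(h(t)) for i = 1,2 and all t ∈ I. -/
open Set

/-- `δ₁, δ₂ : I → I` (with derivative functions `d₁, d₂` on `I`) form a *regular quasi
P-configuration* in `I = [-1,1]`: they are `C¹` with strictly positive derivatives and the
endpoint conditions hold (the condition `d₁ + d₂ = 1` is not required). -/
structure RegQuasiPConfig (δ₁ δ₂ d₁ d₂ : ℝ → ℝ) : Prop where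
  maps₁ : MapsTo δ₁ Iseg Iseg
  maps₂ : MapsTo δ₂ Iseg Iseg
  hasDeriv₁ : ∀ t ∈ Iseg, HasDerivWithinAt δ₁ (d₁ t) Iseg t
  hasDeriv₂ : ∀ t ∈ Iseg, HasDerivWithinAt δ₂ (d₂ t) Iseg t
  contDeriv₁ : ContinuousOn d₁ Iseg
  contDeriv₂ : ContinuousOn d₂ Iseg
  derivPos₁ : ∀ t ∈ Iseg, 0 < d₁ t
  derivPos₂ : ∀ t ∈ Iseg, 0 < d₂ t
  fix₂ : δ₂ (-1) = -1
  mid₂ : δ₂ 1 = 0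
  mid₁ : δ₁ (-1) = 0
  fix₁ : δ₁ 1 = 1

/-- A piecewise functional equation with contracting outer maps has a unique continuous solution
with the endpoints fixed. -/
theorem existsUnique_piecewise_functional_eq {α : Type*} [MetricSpace α] [CompactSpace α]
    [LinearOrder α] [OrderClosedTopology α] {a c b : α} (hac : a ≤ c) (hcb : c < b)
    (φ ψ s r : C(α, α)) {K : NNReal} (hK : K < 1)
    (hs : LipschitzWith K s) (hr : LipschitzWith K r)
    (hφa : φ a = a) (hφc : φ c = b) (hψc : ψ c = a) (hψb : ψ b = b)
    (hsa : s a = a) (hsb : s b = c) (hra : r a = c) (hrb : r b = b) :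
    ∃! h : C(α, α), h a = a ∧ h b = b ∧
      (∀ x ≤ c, h x = s (h (φ x))) ∧ ∀ x, c ≤ x → h x = r (h (ψ x)) := by
  classical
  let S : Set C(α, α) := {h | h a = a ∧ h b = b}
  have hS : IsClosed S :=
    (isClosed_eq (continuous_eval_const a) continuous_const).inter
      (isClosed_eq (continuous_eval_const b) continuous_const)
  have : CompleteSpace S := hS.completeSpace_coe
  have glue (h : S) : s (h.1 (φ c)) = r (h.1 (ψ c)) := by
    rw [hφc, hψc, h.2.1, h.2.2, hsb, hra]
  let T : S → S := fun h ↦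
    ⟨⟨fun x ↦ if x ≤ c then s (h.1 (φ x)) else r (h.1 (ψ x)), by
      refine Continuous.if_le (by fun_prop) (by fun_prop) continuous_id continuous_const ?_
      rintro x rfl
      exact glue h⟩, by
      refine ⟨?_, ?_⟩
      · simp [hac, hφa, h.2.1, hsa]
      · simp [not_le.2 hcb, hψb, h.2.2, hrb]⟩
  have hT : ContractingWith K T := by
    refine ⟨hK, LipschitzWith.of_dist_le_mul fun h g ↦ ?_⟩
    refine (ContinuousMap.dist_le (by positivity)).2 fun x ↦ ?_
    change dist (if x ≤ c then _ else _) (if x ≤ c then _ else _) ≤ _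
    split_ifs
    · exact (hs.dist_le_mul _ _).trans
        (mul_le_mul_of_nonneg_left (ContinuousMap.dist_apply_le_dist _) K.2)
    · exact (hr.dist_le_mul _ _).trans
        (mul_le_mul_of_nonneg_left (ContinuousMap.dist_apply_le_dist _) K.2)
  have hfix (h : S) : Function.IsFixedPt T h ↔
      (∀ x ≤ c, h.1 x = s (h.1 (φ x))) ∧ ∀ x, c ≤ x → h.1 x = r (h.1 (ψ x)) := by
    have hval (x : α) : (T h).1 x = if x ≤ c then s (h.1 (φ x)) else r (h.1 (ψ x)) := rfl
    constructor
    · intro e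
      have hx (x : α) : h.1 x = if x ≤ c then s (h.1 (φ x)) else r (h.1 (ψ x)) := by
        rw [← hval, e.eq]
      refine ⟨fun x hxc ↦ by rw [hx, if_pos hxc], fun x hcx ↦ ?_⟩
      rcases hcx.eq_or_lt with rfl | hlt
      · rw [hx, if_pos le_rfl, glue]
      · rw [hx, if_neg hlt.not_ge]
    · rintro ⟨h₁, h₂⟩
      refine Subtype.ext (ContinuousMap.ext fun x ↦ ?_)
      rw [hval]
      split_ifs with hxc
      · exact (h₁ x hxc).symm
      · exact (h₂ x (not_le.1 hxc).le).symm
  have : Nonempty S := ⟨⟨ContinuousMap.id α, rfl, rfl⟩⟩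
  let f := ContractingWith.fixedPoint T hT
  refine ⟨f.1, ⟨f.2.1, f.2.2, (hfix f).1 hT.fixedPoint_isFixedPt⟩, ?_⟩
  rintro g ⟨ga, gb, hg⟩
  exact congrArg Subtype.val (hT.fixedPoint_unique ((hfix ⟨g, ga, gb⟩).2 hg))

/-- A continuous strictly increasing function on `[a, b]` has a continuous inverse, which
extends continuously to the whole line with values in `[a, b]`. -/
theorem StrictMonoOn.exists_continuous_inverse {f : ℝ → ℝ} {a b : ℝ} (hab : a ≤ b)
    (hf : StrictMonoOn f (Icc a b)) (hc : ContinuousOn f (Icc a b)) :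
    ∃ g : ℝ → Icc a b, Continuous g ∧ (∀ t : Icc a b, g (f t) = t) ∧
      ∀ x ∈ Icc (f a) (f b), f (g x) = x := by
  have hle : f a ≤ f b := hf.monotoneOn (left_mem_Icc.2 hab) (right_mem_Icc.2 hab) hab
  have hmem (t : Icc a b) : f t ∈ Icc (f a) (f b) :=
    ⟨hf.monotoneOn (left_mem_Icc.2 hab) t.2 t.2.1, hf.monotoneOn t.2 (right_mem_Icc.2 hab) t.2.2⟩
  let F : Icc a b → Icc (f a) (f b) := fun t ↦ ⟨f t, hmem t⟩
  have hF : Function.Bijective F := by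
    refine ⟨fun s t h ↦ Subtype.ext (hf.injOn s.2 t.2 (congrArg Subtype.val h)), fun y ↦ ?_⟩
    obtain ⟨x, hx, hxy⟩ := intermediate_value_Icc hab hc y.2
    exact ⟨⟨x, hx⟩, Subtype.ext hxy⟩
  have hFc : Continuous F := hc.domRestrict.subtype_mk _
  let e : Icc a b ≃ₜ Icc (f a) (f b) :=
    Continuous.homeoOfEquivCompactToT2 (f := Equiv.ofBijective F hF) hFc
  refine ⟨IccExtend hle e.symm, e.symm.continuous.Icc_extend', fun t ↦ ?_, fun x hx ↦ ?_⟩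
  · rw [IccExtend_of_mem hle _ (hmem t)]
    exact e.symm_apply_apply t
  · rw [IccExtend_of_mem hle _ hx]
    exact congrArg Subtype.val (e.apply_symm_apply ⟨x, hx⟩)

/-- A continuous positive derivative bounded by `1` on a compact interval makes the function
strictly contracting there. -/
theorem exists_lipschitzOnWith_lt_one {f f' : ℝ → ℝ} {a b : ℝ} (hab : a ≤ b)
    (hf : ∀ t ∈ Icc a b, HasDerivWithinAt f (f' t) (Icc a b) t)
    (hc : ContinuousOn f' (Icc a b)) (hpos : ∀ t ∈ Icc a b, 0 < f' t)
    (hlt : ∀ t ∈ Icc a b, f' t < 1) :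
    ∃ K : NNReal, K < 1 ∧ LipschitzOnWith K f (Icc a b) := by
  obtain ⟨m, hm, hmax⟩ := isCompact_Icc.exists_isMaxOn (nonempty_Icc.2 hab) hc
  refine ⟨NNReal.mk (f' m) (hpos m hm).le, hlt m hm,
    (convex_Icc a b).lipschitzOnWith_of_nnnorm_hasDerivWithin_le hf fun t ht ↦ ?_⟩
  rw [← NNReal.coe_le_coe, coe_nnnorm, Real.norm_of_nonneg (hpos t ht).le]
  exact hmax ht

theorem strictMonoOn_Icc_of_hasDerivWithinAt_pos {f f' : ℝ → ℝ} {a b : ℝ}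
    (hf : ∀ t ∈ Icc a b, HasDerivWithinAt f (f' t) (Icc a b) t)
    (hpos : ∀ t ∈ Icc a b, 0 < f' t) : StrictMonoOn f (Icc a b) :=
  strictMonoOn_of_hasDerivWithinAt_pos (convex_Icc a b) (fun t ht ↦ (hf t ht).continuousWithinAt)
    (fun t ht ↦ (hf t (interior_subset ht)).mono interior_subset)
    fun t ht ↦ hpos t (interior_subset ht)

/-- Given two regular quasi P-configurations with the derivatives of the target system
strictly less than `1`, there is a unique continuous `h : I → I` fixing `-1, 0, 1` and
intertwining them. -/
theorem quasi_pconfig_semiconjugacy (δ₁ δ₂ d₁ d₂ σ₁ σ₂ e₁ e₂ : ℝ → ℝ)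
    (hδ : RegQuasiPConfig δ₁ δ₂ d₁ d₂) (hσ : RegQuasiPConfig σ₁ σ₂ e₁ e₂)
    (he₁ : ∀ t ∈ Iseg, e₁ t < 1) (he₂ : ∀ t ∈ Iseg, e₂ t < 1) :
    ∃ h : ℝ → ℝ,
      (ContinuousOn h Iseg ∧ MapsTo h Iseg Iseg ∧ h (-1) = -1 ∧ h 0 = 0 ∧ h 1 = 1 ∧
        (∀ t ∈ Iseg, h (δ₁ t) = σ₁ (h t)) ∧ (∀ t ∈ Iseg, h (δ₂ t) = σ₂ (h t))) ∧
      ∀ h' : ℝ → ℝ,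
        (ContinuousOn h' Iseg ∧ MapsTo h' Iseg Iseg ∧ h' (-1) = -1 ∧ h' 0 = 0 ∧ h' 1 = 1 ∧
          (∀ t ∈ Iseg, h' (δ₁ t) = σ₁ (h' t)) ∧ (∀ t ∈ Iseg, h' (δ₂ t) = σ₂ (h' t))) →
        EqOn h' h Iseg := by
  have hI : (-1 : ℝ) ≤ 1 := by norm_num
  obtain ⟨φ, hφ, hφδ, hδφ⟩ := (strictMonoOn_Icc_of_hasDerivWithinAt_pos hδ.hasDeriv₂
    hδ.derivPos₂).exists_continuous_inverse hI fun t ht ↦ (hδ.hasDeriv₂ t ht).continuousWithinAt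
  obtain ⟨ψ, hψ, hψδ, hδψ⟩ := (strictMonoOn_Icc_of_hasDerivWithinAt_pos hδ.hasDeriv₁
    hδ.derivPos₁).exists_continuous_inverse hI fun t ht ↦ (hδ.hasDeriv₁ t ht).continuousWithinAt
  rw [hδ.fix₂, hδ.mid₂] at hδφ
  rw [hδ.mid₁, hδ.fix₁] at hδψ
  obtain ⟨K₁, hK₁, hL₁⟩ := exists_lipschitzOnWith_lt_one hI hσ.hasDeriv₁ hσ.contDeriv₁
    hσ.derivPos₁ he₁
  obtain ⟨K₂, hK₂, hL₂⟩ := exists_lipschitzOnWith_lt_one hI hσ.hasDeriv₂ hσ.contDeriv₂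
    hσ.derivPos₂ he₂
  let a : Icc (-1 : ℝ) 1 := ⟨-1, by norm_num⟩
  let c : Icc (-1 : ℝ) 1 := ⟨0, by norm_num⟩
  let b : Icc (-1 : ℝ) 1 := ⟨1, by norm_num⟩
  have hs : LipschitzWith (max K₁ K₂) (hσ.maps₂.restrict σ₂ (Icc (-1 : ℝ) 1) (Icc (-1) 1)) :=
    (hL₂.mapsToRestrict hσ.maps₂).weaken (le_max_right _ _)
  have hr : LipschitzWith (max K₁ K₂) (hσ.maps₁.restrict σ₁ (Icc (-1 : ℝ) 1) (Icc (-1) 1)) :=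
    (hL₁.mapsToRestrict hσ.maps₁).weaken (le_max_left _ _)
  have hφa : φ (-1) = a := by simpa [a, hδ.fix₂] using hφδ a
  have hφc : φ 0 = b := by simpa [b, hδ.mid₂] using hφδ b
  have hψc : ψ 0 = a := by simpa [a, hδ.mid₁] using hψδ a
  have hψb : ψ 1 = b := by simpa [b, hδ.fix₁] using hψδ b
  have hδ₁ (t : Icc (-1 : ℝ) 1) : 0 ≤ δ₁ t := by
    rw [← hδ.mid₁]
    exact (strictMonoOn_Icc_of_hasDerivWithinAt_pos hδ.hasDeriv₁ hδ.derivPos₁).monotoneOn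
      a.2 t.2 t.2.1
  have hδ₂ (t : Icc (-1 : ℝ) 1) : δ₂ t ≤ 0 := by
    rw [← hδ.mid₂]
    exact (strictMonoOn_Icc_of_hasDerivWithinAt_pos hδ.hasDeriv₂ hδ.derivPos₂).monotoneOn
      t.2 b.2 t.2.2
  obtain ⟨h, ⟨ha, hb, hle, hge⟩, huniq⟩ := existsUnique_piecewise_functional_eq
    (a := a) (c := c) (b := b) (Subtype.mk_le_mk.2 (by norm_num)) (Subtype.mk_lt_mk.2 (by norm_num))
    ⟨fun x ↦ φ x, by fun_prop⟩ ⟨fun x ↦ ψ x, by fun_prop⟩ ⟨_, hs.continuous⟩ ⟨_, hr.continuous⟩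
    (max_lt hK₁ hK₂) hs hr hφa hφc hψc hψb (Subtype.ext hσ.fix₂) (Subtype.ext hσ.mid₂)
    (Subtype.ext hσ.mid₁) (Subtype.ext hσ.fix₁)
  have hext (x : Icc (-1 : ℝ) 1) : (IccExtend hI h x).1 = h x := by rw [IccExtend_val]
  refine ⟨fun x ↦ (IccExtend hI h x).1, ⟨?_, fun x _ ↦ (IccExtend hI h x).2, ?_, ?_, ?_, ?_, ?_⟩, ?_⟩
  · exact (continuous_subtype_val.comp h.continuous.Icc_extend').continuousOn
  · exact (hext a).trans (congrArg Subtype.val ha)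
  · refine (hext c).trans ?_
    rw [hle c le_rfl]
    change σ₂ (h (φ 0)) = 0
    rw [hφc, hb, hσ.mid₂]
  · exact (hext b).trans (congrArg Subtype.val hb)
  · intro t ht
    have e := hge ⟨δ₁ t, hδ.maps₁ ht⟩ (hδ₁ ⟨t, ht⟩)
    refine (hext ⟨δ₁ t, hδ.maps₁ ht⟩).trans ((congrArg Subtype.val e).trans ?_)
    change σ₁ (h (ψ (δ₁ t))) = _
    rw [hψδ ⟨t, ht⟩, ← hext]
  · intro t ht
    have e := hle ⟨δ₂ t, hδ.maps₂ ht⟩ (hδ₂ ⟨t, ht⟩)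
    refine (hext ⟨δ₂ t, hδ.maps₂ ht⟩).trans ((congrArg Subtype.val e).trans ?_)
    change σ₂ (h (φ (δ₂ t))) = _
    rw [hφδ ⟨t, ht⟩, ← hext]
  · rintro g ⟨gc, gI, ga, -, gb, g₁, g₂⟩ x hx
    have e := huniq ⟨gI.restrict g (Icc (-1 : ℝ) 1) (Icc (-1) 1), gc.mapsToRestrict gI⟩
      ⟨Subtype.ext ga, Subtype.ext gb, fun y hy ↦ Subtype.ext ?_, fun y hy ↦ Subtype.ext ?_⟩
    · refine Eq.trans ?_ (hext ⟨x, hx⟩).symm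
      rw [← e]
      rfl
    · change g y = σ₂ (g (φ y))
      rw [← g₂ _ (φ y).2, hδφ y ⟨y.2.1, hy⟩]
    · change g y = σ₁ (g (ψ y))
      rw [← g₁ _ (ψ y).2, hδψ y ⟨hy, y.2.2⟩]
end

section
/- Let δ₁, δ₂ form a regular P-configuration in I = [-1,1]. Then the functional equation f(t) = f(δ₁(t)) + f(δ₂(t)), t ∈ I, has a nonlinear continuous solution: there exists a continuous f : I → ℝ satisfying the equation for all t ∈ I such that there is no c ∈ ℝ with f(z) = c·z for all z ∈ I. -/
open Set

open scoped BoundedContinuousFunction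

/-- The inverse of a continuous strictly increasing function on `[a, b]`, extended by constants. -/
theorem exists_continuous_clamped_inverse {a b : ℝ} (hab : a ≤ b) {δ : ℝ → ℝ}
    (hmono : StrictMonoOn δ (Icc a b)) (hcont : ContinuousOn δ (Icc a b)) :
    ∃ g : ℝ → ℝ, Continuous g ∧ (∀ s, g s ∈ Icc a b) ∧ (∀ t ∈ Icc a b, g (δ t) = t) ∧
      (∀ s ≤ δ a, g s = a) ∧ (∀ s, δ b ≤ s → g s = b) := by
  have ha : a ∈ Icc a b := left_mem_Icc.2 hab
  have hb : b ∈ Icc a b := right_mem_Icc.2 hab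
  have hδ : δ a ≤ δ b := hmono.monotoneOn ha hb hab
  have hmaps : MapsTo δ (Icc a b) (Icc (δ a) (δ b)) := hmono.monotoneOn.mapsTo_Icc
  have hbij : Function.Bijective (hmaps.restrict δ _ _) :=
    ⟨hmaps.restrict_inj.2 hmono.injOn,
      (MapsTo.restrict_surjective_iff hmaps).2 (intermediate_value_Icc hab hcont)⟩
  let e : Icc a b ≃ₜ Icc (δ a) (δ b) :=
    Continuous.homeoOfEquivCompactToT2 (f := Equiv.ofBijective _ hbij)
      (hcont.mapsToRestrict hmaps)
  have he (t : ℝ) (ht : t ∈ Icc a b) (h : δ t ∈ Icc (δ a) (δ b)) :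
      e.symm ⟨δ t, h⟩ = ⟨t, ht⟩ := e.symm_apply_eq.2 rfl
  refine ⟨IccExtend hδ fun y => (e.symm y : ℝ),
    (continuous_subtype_val.comp e.symm.continuous).Icc_extend', fun s => (e.symm _).2,
    fun t ht => ?_, fun s hs => ?_, fun s hs => ?_⟩
  · rw [IccExtend_of_mem _ _ (hmaps ht), he t ht]
  · rw [IccExtend_of_le_left _ _ hs, he a ha]
  · rw [IccExtend_of_right_le _ _ hs, he b hb]

/-- A continuous solution of a de Rham type system: if `g₁ = -1` on `(-∞, 0]` and `g₂ = 1` on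
`[0, ∞)`, the averaging operator is a contraction on the functions vanishing at `±1`. -/
theorem exists_continuous_averaging_fixedPoint {g₁ g₂ : ℝ → ℝ}
    (hg₁ : Continuous g₁) (hg₂ : Continuous g₂)
    (hneg₁ : ∀ s ≤ 0, g₁ s = -1) (hpos₂ : ∀ s, 0 ≤ s → g₂ s = 1)
    (hone₁ : g₁ 1 = 1) (hneg_one₂ : g₂ (-1) = -1)
    (u : ℝ →ᵇ ℝ) :
    ∃ f : ℝ → ℝ, Continuous f ∧ f 1 = 0 ∧ f (-1) = 0 ∧
      ∀ s, f s = (f (g₁ s) + f (g₂ s)) / 2 + u (g₁ s) - u (g₂ s) := by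
  let S : Set (ℝ →ᵇ ℝ) := {f | f 1 = 0 ∧ f (-1) = 0}
  have hS : IsClosed S :=
    (isClosed_eq (continuous_eval_const (1 : ℝ))
      continuous_const).inter
      (isClosed_eq (continuous_eval_const (-1 : ℝ)) continuous_const)
  have : CompleteSpace S := hS.completeSpace_coe
  have : Nonempty S := ⟨⟨0, rfl, rfl⟩⟩
  let comp (f : ℝ →ᵇ ℝ) (g : ℝ → ℝ) (hg : Continuous g) : ℝ →ᵇ ℝ := f.compContinuous ⟨g, hg⟩
  let Φ (f : ℝ →ᵇ ℝ) : ℝ →ᵇ ℝ :=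
    (1 / 2 : ℝ) • (comp f g₁ hg₁ + comp f g₂ hg₂) + comp u g₁ hg₁ - comp u g₂ hg₂
  have hΦ (f : ℝ →ᵇ ℝ) (s : ℝ) :
      Φ f s = (f (g₁ s) + f (g₂ s)) / 2 + u (g₁ s) - u (g₂ s) := by
    simp [Φ, comp]
    ring
  have hΦS (f : S) : Φ f ∈ S := by
    obtain ⟨f, h₁, h₂⟩ := f
    constructor
    · simp [hΦ, hone₁, hpos₂ 1 zero_le_one, h₁]
    · simp [hΦ, hneg_one₂, hneg₁ (-1) (by norm_num), h₂]
  let Ψ (f : S) : S := ⟨Φ f, hΦS f⟩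
  have hΨ : ContractingWith (1 / 2) Ψ := by
    refine ⟨by rw [← NNReal.coe_lt_coe]; norm_num, LipschitzWith.of_dist_le_mul fun f k => ?_⟩
    rw [Subtype.dist_eq, Subtype.dist_eq, BoundedContinuousFunction.dist_le (by positivity)]
    intro s
    have key (x : ℝ) : |f.1 x - k.1 x| ≤ dist f.1 k.1 :=
      BoundedContinuousFunction.dist_coe_le_dist (f := f.1) (g := k.1) x
    simp only [Ψ, hΦ, Real.dist_eq]
    rcases le_total s 0 with hs | hs
    · rw [hneg₁ s hs, f.2.2, k.2.2]
      have := abs_le.1 (key (g₂ s))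
      rw [abs_le]
      push_cast
      constructor <;> linarith
    · rw [hpos₂ s hs, f.2.1, k.2.1]
      have := abs_le.1 (key (g₁ s))
      rw [abs_le]
      push_cast
      constructor <;> linarith
  let f := ContractingWith.fixedPoint Ψ hΨ
  have hf : Φ f = f := congrArg Subtype.val hΨ.fixedPoint_isFixedPt
  exact ⟨f.1, f.1.continuous, f.2.1, f.2.2, fun s => by rw [← hΦ, hf]⟩

/-- A function with positive one-sided derivative on `I` is strictly increasing there. -/
theorem strictMonoOn_Iseg_of_hasDerivWithinAt_pos {δ d : ℝ → ℝ}
    (hδ : ∀ t ∈ Iseg, HasDerivWithinAt δ (d t) Iseg t) (hd : ∀ t ∈ Iseg, 0 < d t) :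
    StrictMonoOn δ Iseg :=
  strictMonoOn_of_hasDerivWithinAt_pos (D := Iseg) (convex_Icc _ _)
    (fun t ht => (hδ t ht).continuousWithinAt)
    (fun t ht => (hδ t (interior_subset ht)).mono interior_subset)
    (fun t ht => hd t (interior_subset ht))

/-- For every regular P-configuration the homogeneous Cauchy type functional equation has a
continuous nonlinear solution. -/
theorem exists_nonlinear_solution (δ₁ δ₂ d₁ d₂ : ℝ → ℝ)
    (hP : RegPConfig δ₁ δ₂ d₁ d₂) :
    ∃ f : ℝ → ℝ, ContinuousOn f Iseg ∧
      (∀ t ∈ Iseg, f t = f (δ₁ t) + f (δ₂ t)) ∧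
      ¬ ∃ c : ℝ, ∀ z ∈ Iseg, f z = c * z := by
  have hle : (-1 : ℝ) ≤ 1 := by norm_num
  have hl : (-1 : ℝ) ∈ Iseg := left_mem_Icc.2 hle
  have hr : (1 : ℝ) ∈ Iseg := right_mem_Icc.2 hle
  have hm₁ := strictMonoOn_Iseg_of_hasDerivWithinAt_pos hP.hasDeriv₁ hP.derivPos₁
  have hm₂ := strictMonoOn_Iseg_of_hasDerivWithinAt_pos hP.hasDeriv₂ hP.derivPos₂
  obtain ⟨g₁, hg₁, -, hinv₁, hleft₁, -⟩ := exists_continuous_clamped_inverse hle hm₁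
    fun t ht => (hP.hasDeriv₁ t ht).continuousWithinAt
  obtain ⟨g₂, hg₂, -, hinv₂, -, hright₂⟩ := exists_continuous_clamped_inverse hle hm₂
    fun t ht => (hP.hasDeriv₂ t ht).continuousWithinAt
  rw [hP.mid₁] at hleft₁
  rw [hP.mid₂] at hright₂
  have hone₁ := hinv₁ 1 hr
  rw [hP.fix₁] at hone₁
  have hneg_one₂ := hinv₂ (-1) hl
  rw [hP.fix₂] at hneg_one₂
  let u : ℝ →ᵇ ℝ := BoundedContinuousFunction.ofNormedAddCommGroup
    (fun t => max 0 (1 - t ^ 2)) (by fun_prop) 1 fun t => by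
      rw [Real.norm_of_nonneg (le_max_left _ _)]
      exact max_le zero_le_one (by nlinarith [sq_nonneg t])
  have hu : u 1 = 0 := by simp [u]
  have hu' : u (-1) = 0 := by simp [u]
  have hu₀ : u 0 = 1 := by simp [u]
  obtain ⟨f, hf, hf₁, hf₂, hfix⟩ := exists_continuous_averaging_fixedPoint hg₁ hg₂ hleft₁ hright₂
    hone₁ hneg_one₂ u
  have h₁ (t : ℝ) (ht : t ∈ Iseg) : f (δ₁ t) = f t / 2 + u t := by
    have h0 : 0 ≤ δ₁ t := hP.mid₁ ▸ hm₁.monotoneOn hl ht ht.1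
    rw [hfix, hinv₁ t ht, hright₂ _ h0, hf₁, hu]
    ring
  have h₂ (t : ℝ) (ht : t ∈ Iseg) : f (δ₂ t) = f t / 2 - u t := by
    have h0 : δ₂ t ≤ 0 := hP.mid₂ ▸ hm₂.monotoneOn ht hr ht.2
    rw [hfix, hinv₂ t ht, hleft₁ _ h0, hf₂, hu']
    ring
  refine ⟨f, hf.continuousOn, fun t ht => by rw [h₁ t ht, h₂ t ht]; ring, ?_⟩
  rintro ⟨c, hc⟩
  have h0 : (0 : ℝ) ∈ Iseg := ⟨by norm_num, zero_le_one⟩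
  have hc0 : c = 0 := by simpa [hf₁] using (hc 1 hr).symm
  have hz := h₁ 0 h0
  rw [hc _ (hP.maps₁ h0), hc 0 h0, hc0, hu₀] at hz
  norm_num at hz
end

section
/- There exists a continuous function f : [-1,1] → ℝ satisfying f(t) = f((t+1)/2) + f((t-1)/2) for all t ∈ [-1,1] which is not linear, i.e., there is no c ∈ ℝ with f(z) = c·z for all z ∈ [-1,1]. -/
open Set

/-- The Weierstrass-type function `x ↦ ∑ 2⁻ⁿ cos (2ⁿ π x)`. -/
noncomputable def dyadicCosSeries (x : ℝ) : ℝ :=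
  ∑' n : ℕ, (1 / 2 : ℝ) ^ n * Real.cos (2 ^ n * (Real.pi * x))

lemma norm_dyadicCosSeries_term_le (n : ℕ) (x : ℝ) :
    ‖(1 / 2 : ℝ) ^ n * Real.cos (2 ^ n * (Real.pi * x))‖ ≤ (1 / 2 : ℝ) ^ n := by
  rw [norm_mul, Real.norm_of_nonneg (by positivity)]
  exact mul_le_of_le_one_right (by positivity) (Real.abs_cos_le_one _)

lemma continuous_dyadicCosSeries : Continuous dyadicCosSeries :=
  continuous_tsum (fun n => by fun_prop) summable_geometric_two norm_dyadicCosSeries_term_le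

lemma dyadicCosSeries_eq_cos_add (x : ℝ) :
    dyadicCosSeries x = Real.cos (Real.pi * x) + dyadicCosSeries (2 * x) / 2 := by
  have hs := Summable.of_norm_bounded summable_geometric_two
    (fun n => norm_dyadicCosSeries_term_le n x)
  rw [dyadicCosSeries, hs.tsum_eq_zero_add, dyadicCosSeries, ← tsum_div_const]
  congr 1
  · simp
  · refine tsum_congr fun n => ?_
    rw [show (2 : ℝ) ^ (n + 1) * (Real.pi * x) = 2 ^ n * (Real.pi * (2 * x)) by ring]
    ring

lemma dyadicCosSeries_add_two (x : ℝ) : dyadicCosSeries (x + 2) = dyadicCosSeries x := by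
  refine tsum_congr fun n => ?_
  have h := Real.cos_add_nat_mul_two_pi (2 ^ n * (Real.pi * x)) (2 ^ n)
  rw [← h]
  push_cast
  ring_nf

lemma dyadicCosSeries_add_dyadicCosSeries_add_one (x : ℝ) :
    dyadicCosSeries (x + 1) + dyadicCosSeries x = dyadicCosSeries (2 * x) := by
  rw [dyadicCosSeries_eq_cos_add (x + 1), dyadicCosSeries_eq_cos_add x, mul_add, mul_add,
    mul_one, mul_one, dyadicCosSeries_add_two, Real.cos_add_pi]
  ring

lemma dyadicCosSeries_zero : dyadicCosSeries 0 = 2 := by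
  have h := dyadicCosSeries_eq_cos_add 0
  simp only [mul_zero, Real.cos_zero] at h
  linarith

/-- There is a continuous nonlinear solution of `f(t) = f((t+1)/2) + f((t-1)/2)` on
`[-1,1]`. -/
theorem exists_nonlinear_solution_special :
    ∃ f : ℝ → ℝ, ContinuousOn f Iseg ∧
      (∀ t ∈ Iseg, f t = f ((t + 1) / 2) + f ((t - 1) / 2)) ∧
      ¬ ∃ c : ℝ, ∀ z ∈ Iseg, f z = c * z := by
  refine ⟨fun t => dyadicCosSeries (t + 1),
    (continuous_dyadicCosSeries.comp (by fun_prop)).continuousOn, fun t _ => ?_, ?_⟩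
  · have h := dyadicCosSeries_add_dyadicCosSeries_add_one ((t + 1) / 2)
    rw [mul_div_cancel₀ _ (two_ne_zero' ℝ)] at h
    simp only
    rw [show (t - 1) / 2 + 1 = (t + 1) / 2 by ring, h]
  · rintro ⟨c, hc⟩
    have h₁ := hc 1 (by norm_num [Iseg])
    have h₂ := hc (-1) (by norm_num [Iseg])
    have h₃ := dyadicCosSeries_add_two 0
    norm_num [dyadicCosSeries_zero] at h₁ h₂ h₃
    linarith
end

section
/- Let (I, δ₁, δ₂) and (I, σ₁, σ₂) be two regular P-configurations, and let f : I → I be a continuous function such that f(δᵢ(t)) = σᵢ(f(t)) for i = 1,2 and all t ∈ I. Then f satisfies f(t) = f(δ₁(t)) + f(δ₂(t)) for all t ∈ I. -/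
open Set

/-- The two maps of a regular P-configuration add up to the identity on `I`. -/
theorem RegPConfig.add_eq_self_s10 {δ₁ δ₂ d₁ d₂ : ℝ → ℝ} (h : RegPConfig δ₁ δ₂ d₁ d₂) {t : ℝ}
    (ht : t ∈ Iseg) : δ₁ t + δ₂ t = t := by
  have hderiv : ∀ x ∈ Iseg, HasDerivWithinAt (fun x => δ₁ x + δ₂ x - x) 0 Iseg x := by
    intro x hx
    have hx' := ((h.hasDeriv₁ x hx).add (h.hasDeriv₂ x hx)).sub (hasDerivWithinAt_id x Iseg)
    rwa [h.derivSum x hx, sub_self] at hx'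
  have hmem : (-1 : ℝ) ∈ Iseg := by norm_num [Iseg]
  have hle := (convex_Icc (-1 : ℝ) 1).norm_image_sub_le_of_norm_hasDerivWithin_le
    (C := 0) hderiv (fun _ _ => by simp) hmem ht
  have hconst := norm_le_zero_iff.mp (hle.trans_eq (zero_mul _))
  simp only [h.mid₁, h.fix₂] at hconst
  linarith

/-- A continuous map `f : I → I` intertwining two regular P-configurations satisfies the
homogeneous Cauchy type functional equation. -/
theorem conjugation_solves_equation (δ₁ δ₂ d₁ d₂ σ₁ σ₂ e₁ e₂ f : ℝ → ℝ)
    (hδ : RegPConfig δ₁ δ₂ d₁ d₂) (hσ : RegPConfig σ₁ σ₂ e₁ e₂)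
    (hf : ContinuousOn f Iseg) (hmaps : MapsTo f Iseg Iseg)
    (hconj₁ : ∀ t ∈ Iseg, f (δ₁ t) = σ₁ (f t))
    (hconj₂ : ∀ t ∈ Iseg, f (δ₂ t) = σ₂ (f t)) :
    ∀ t ∈ Iseg, f t = f (δ₁ t) + f (δ₂ t) := by
  intro t ht
  rw [hconj₁ t ht, hconj₂ t ht, hσ.add_eq_self_s10 (hmaps ht)]
end

section
/- Let δ₁, δ₂ form a regular quasi P-configuration in I = [-1,1]. Then the functional equation f(t) = f(δ₁(t)) + f(δ₂(t)), t ∈ I, has a nontrivial continuous solution: there exists a continuous f : I → I with f(-1) = -1, f(0) = 0, f(1) = 1 (in particular f is not identically zero) satisfying the equation for all t ∈ I. -/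
open Set

open scoped BoundedContinuousFunction

/-- A continuous strictly increasing function on a compact interval has a continuous left inverse
defined on the whole line. -/
theorem exists_continuous_leftInvOn_Icc {a b : ℝ} (hab : a ≤ b) {g : ℝ → ℝ}
    (hc : ContinuousOn g (Icc a b)) (hm : StrictMonoOn g (Icc a b)) :
    ∃ p : ℝ → ℝ, Continuous p ∧ LeftInvOn p g (Icc a b) := by
  have ha : a ∈ Icc a b := left_mem_Icc.2 hab
  have hb : b ∈ Icc a b := right_mem_Icc.2 hab
  have hgab : g a ≤ g b := hm.monotoneOn ha hb hab
  have hmaps : MapsTo g (Icc a b) (Icc (g a) (g b)) := hm.monotoneOn.mapsTo_Icc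
  have hmono : StrictMono (hmaps.restrict g (Icc a b) (Icc (g a) (g b))) :=
    fun x y hxy => hm x.2 y.2 hxy
  have hsurj : Function.Surjective (hmaps.restrict g (Icc a b) (Icc (g a) (g b))) := by
    rintro ⟨y, hy⟩
    obtain ⟨x, hx, rfl⟩ := intermediate_value_Icc hab hc hy
    exact ⟨⟨x, hx⟩, rfl⟩
  let e := hmono.orderIsoOfSurjective _ hsurj
  refine ⟨fun x => e.symm (projIcc (g a) (g b) hgab x),
    continuous_subtype_val.comp (e.symm.continuous.comp continuous_projIcc), fun t ht => ?_⟩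
  have h : projIcc (g a) (g b) hgab (g t) = e ⟨t, ht⟩ := projIcc_of_mem hgab (hmaps ht)
  simp [h]

/-- A function on `[-1, 1]` with positive derivative is continuous and strictly increasing there. -/
theorem continuousOn_and_strictMonoOn_of_hasDerivWithinAt_pos {g d : ℝ → ℝ}
    (hd : ∀ t ∈ Iseg, HasDerivWithinAt g (d t) Iseg t) (hpos : ∀ t ∈ Iseg, 0 < d t) :
    ContinuousOn g Iseg ∧ StrictMonoOn g Iseg := by
  have hc : ContinuousOn g Iseg := fun t ht => (hd t ht).continuousWithinAt
  refine ⟨hc, strictMonoOn_of_hasDerivWithinAt_pos (convex_Icc (-1) 1) hc (f' := d)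
    (fun t ht => (hd t (interior_subset ht)).mono interior_subset)
    fun t ht => hpos t (interior_subset ht)⟩

/-- The bounded continuous functions on the line with values in `[-1, 1]` and fixing `-1`
and `1`. -/
def endpointFixing : Set (ℝ →ᵇ ℝ) := {h | (∀ x, h x ∈ Iseg) ∧ h (-1) = -1 ∧ h 1 = 1}

theorem isClosed_endpointFixing : IsClosed endpointFixing := by
  have hev (x : ℝ) : Continuous fun h : ℝ →ᵇ ℝ => h x := by fun_prop
  have hI : IsClosed {h : ℝ →ᵇ ℝ | ∀ x, h x ∈ Iseg} := by
    rw [ofPred_forall]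
    exact isClosed_iInter fun x => isClosed_Icc.preimage (hev x)
  exact hI.inter ((isClosed_eq (hev _) continuous_const).inter
    (isClosed_eq (hev _) continuous_const))

theorem endpointFixing_nonempty : endpointFixing.Nonempty := by
  have hI (x : ℝ) : max (-1) (min 1 x) ∈ Iseg := ⟨le_max_left _ _, by simp⟩
  refine ⟨BoundedContinuousFunction.ofNormedAddCommGroup (fun x => max (-1) (min 1 x))
    (by fun_prop) 1 fun x => abs_le.2 (hI x), hI, ?_, ?_⟩ <;> simp

/-- Averaging over two continuous reparametrizations of the line. -/
noncomputable def averageComp (q₁ q₂ : C(ℝ, ℝ)) (h : ℝ →ᵇ ℝ) : ℝ →ᵇ ℝ :=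
  (2⁻¹ : ℝ) • (h.compContinuous q₁ + h.compContinuous q₂)

theorem averageComp_apply (q₁ q₂ : C(ℝ, ℝ)) (h : ℝ →ᵇ ℝ) (x : ℝ) :
    averageComp q₁ q₂ h x = 2⁻¹ * (h (q₁ x) + h (q₂ x)) := rfl

/-- If `q₁` is `-1` on the nonpositive half-line, `q₂` is `1` on the nonnegative half-line,
`q₁ 1 = 1` and `q₂ (-1) = -1`, then averaging has a fixed point among the functions fixing the
endpoints: there it contracts by the factor `1/2`. -/
theorem exists_averageComp_eq_self {q₁ q₂ : C(ℝ, ℝ)} (hq₁ : ∀ x ≤ 0, q₁ x = -1)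
    (hq₂ : ∀ x, 0 ≤ x → q₂ x = 1) (h₁ : q₁ 1 = 1) (h₂ : q₂ (-1) = -1) :
    ∃ h ∈ endpointFixing, averageComp q₁ q₂ h = h := by
  have hmaps : MapsTo (averageComp q₁ q₂) endpointFixing endpointFixing := by
    rintro h ⟨hI, hl, hr⟩
    refine ⟨fun x => ?_, ?_, ?_⟩
    · obtain ⟨a₁, b₁⟩ := hI (q₁ x)
      obtain ⟨a₂, b₂⟩ := hI (q₂ x)
      rw [averageComp_apply]
      constructor <;> linarith
    · rw [averageComp_apply, hq₁ _ (by norm_num), h₂, hl]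
      norm_num
    · rw [averageComp_apply, hq₂ _ (by norm_num), h₁, hr]
      norm_num
  have hcontr : ContractingWith 2⁻¹ (hmaps.restrict _ endpointFixing endpointFixing) := by
    refine ⟨by rw [inv_lt_one₀] <;> norm_num, LipschitzWith.of_dist_le_mul ?_⟩
    rintro ⟨h, -, hl, hr⟩ ⟨k, -, kl, kr⟩
    change dist (averageComp q₁ q₂ h) (averageComp q₁ q₂ k) ≤ (2⁻¹ : ℝ) * dist h k
    refine (BoundedContinuousFunction.dist_le (by positivity)).2 fun x => ?_
    rw [averageComp_apply, averageComp_apply, Real.dist_eq, ← mul_sub, abs_mul,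
      abs_of_pos (by norm_num : (0 : ℝ) < 2⁻¹)]
    refine mul_le_mul_of_nonneg_left ?_ (by norm_num)
    rcases le_total x 0 with hx | hx
    · rw [hq₁ x hx, hl, kl, add_sub_add_left_eq_sub]
      exact BoundedContinuousFunction.dist_coe_le_dist (f := h) (g := k) _
    · rw [hq₂ x hx, hr, kr, add_sub_add_right_eq_sub]
      exact BoundedContinuousFunction.dist_coe_le_dist (f := h) (g := k) _
  obtain ⟨h₀, hh₀⟩ := endpointFixing_nonempty
  obtain ⟨h, hh, hfix, -⟩ := ContractingWith.exists_fixedPoint'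
    isClosed_endpointFixing.isComplete hmaps hcontr hh₀ (edist_ne_top _ _)
  exact ⟨h, hh, hfix⟩

/-- For every regular quasi P-configuration, the functional equation
`f(t) = f(δ₁ t) + f(δ₂ t)` has a nontrivial continuous solution `f : I → I` with
`f(-1) = -1`, `f(0) = 0`, `f(1) = 1`. -/
theorem exists_nontrivial_solution_quasi (δ₁ δ₂ d₁ d₂ : ℝ → ℝ)
    (hP : RegQuasiPConfig δ₁ δ₂ d₁ d₂) :
    ∃ f : ℝ → ℝ, ContinuousOn f Iseg ∧ MapsTo f Iseg Iseg ∧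
      f (-1) = -1 ∧ f 0 = 0 ∧ f 1 = 1 ∧
      ∀ t ∈ Iseg, f t = f (δ₁ t) + f (δ₂ t) := by
  obtain ⟨hc₁, hm₁⟩ := continuousOn_and_strictMonoOn_of_hasDerivWithinAt_pos
    hP.hasDeriv₁ hP.derivPos₁
  obtain ⟨hc₂, hm₂⟩ := continuousOn_and_strictMonoOn_of_hasDerivWithinAt_pos
    hP.hasDeriv₂ hP.derivPos₂
  obtain ⟨p₁, hp₁, hinv₁⟩ := exists_continuous_leftInvOn_Icc (a := -1) (b := 1) (by norm_num) hc₁ hm₁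
  obtain ⟨p₂, hp₂, hinv₂⟩ := exists_continuous_leftInvOn_Icc (a := -1) (b := 1) (by norm_num) hc₂ hm₂
  have hl : (-1 : ℝ) ∈ Iseg := by norm_num [Iseg]
  have hr : (1 : ℝ) ∈ Iseg := by norm_num [Iseg]
  have hp₁l : p₁ 0 = -1 := by simpa [hP.mid₁] using hinv₁ hl
  have hp₁r : p₁ 1 = 1 := by simpa [hP.fix₁] using hinv₁ hr
  have hp₂l : p₂ (-1) = -1 := by simpa [hP.fix₂] using hinv₂ hl
  have hp₂r : p₂ 0 = 1 := by simpa [hP.mid₂] using hinv₂ hr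
  -- Extending the inverse branches by constants makes the averaging operator the usual
  -- piecewise one, whose fixed points conjugate the branches to `t ↦ (t ± 1) / 2`.
  let q₁ : C(ℝ, ℝ) := ⟨fun x => p₁ (max x 0), by fun_prop⟩
  let q₂ : C(ℝ, ℝ) := ⟨fun x => p₂ (min x 0), by fun_prop⟩
  have hq₁ (x : ℝ) (hx : x ≤ 0) : q₁ x = -1 := by simp [q₁, hx, hp₁l]
  have hq₂ (x : ℝ) (hx : 0 ≤ x) : q₂ x = 1 := by simp [q₂, hx, hp₂r]
  obtain ⟨h, ⟨hI, hhl, hhr⟩, hfix⟩ := exists_averageComp_eq_self hq₁ hq₂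
    (by simp [q₁, hp₁r]) (by simp [q₂, hp₂l])
  have heq (x : ℝ) : h x = 2⁻¹ * (h (q₁ x) + h (q₂ x)) := by
    rw [← averageComp_apply, hfix]
  refine ⟨h, h.continuous.continuousOn, fun x _ => hI x, hhl, ?_, hhr, fun t ht => ?_⟩
  · rw [heq, hq₁ 0 le_rfl, hq₂ 0 le_rfl, hhl, hhr]
    norm_num
  · have hδ₁ : 0 ≤ δ₁ t := hP.mid₁ ▸ hm₁.monotoneOn hl ht ht.1
    have hδ₂ : δ₂ t ≤ 0 := hP.mid₂ ▸ hm₂.monotoneOn ht hr ht.2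
    have e₁ : q₁ (δ₁ t) = t := by simpa [q₁, hδ₁] using hinv₁ ht
    have e₂ : q₂ (δ₂ t) = t := by simpa [q₂, hδ₂] using hinv₂ ht
    rw [heq (δ₁ t), heq (δ₂ t), e₁, e₂, hq₂ _ hδ₁, hq₁ _ hδ₂, hhl, hhr]
    ring
end

section
/- There exists a strictly increasing homeomorphism h of [-1,1] onto itself with h(-1) = -1, h(0) = 0, h(1) = 1, satisfying h(t) = h((t+1)/2) + h((t-1)/2) for all t ∈ [-1,1], such that h is not continuously differentiable (and in particular h is not the identity and not linear). -/
open Set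

/-- `h` restricts to a homeomorphism of `I = [-1,1]` onto itself: it is continuous on `I`,
maps `I` into `I`, and has a continuous inverse `g : I → I`. -/
def IsHomeoOfIcc (h : ℝ → ℝ) : Prop :=
  ContinuousOn h Iseg ∧ MapsTo h Iseg Iseg ∧
    ∃ g : ℝ → ℝ, ContinuousOn g Iseg ∧ MapsTo g Iseg Iseg ∧
      (∀ t ∈ Iseg, g (h t) = t) ∧ (∀ t ∈ Iseg, h (g t) = t)

open Filter Topology BoundedContinuousFunction

/-- Bounded continuous monotone functions equal to `-1` left of `-1` and to `1` right
of `1`. -/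
def clampedMonotone : Set (ℝ →ᵇ ℝ) :=
  {f | Monotone f ∧ (∀ x ≤ -1, f x = -1) ∧ ∀ x, 1 ≤ x → f x = 1}

theorem isClosed_clampedMonotone : IsClosed clampedMonotone := by
  have hc (x : ℝ) : Continuous fun f : ℝ →ᵇ ℝ => f x := continuous_eval_const x
  simp only [clampedMonotone, Monotone, ofPred_and, ofPred_forall]
  exact (isClosed_iInter fun x => isClosed_iInter fun y => isClosed_iInter fun _ =>
    isClosed_le (hc x) (hc y)).inter <|
    (isClosed_iInter fun x => isClosed_iInter fun _ => isClosed_eq (hc x) continuous_const).inter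
    (isClosed_iInter fun x => isClosed_iInter fun _ => isClosed_eq (hc x) continuous_const)

theorem clampedMonotone_nonempty : clampedMonotone.Nonempty := by
  refine ⟨.ofNormedAddCommGroup (fun x => max (-1) (min 1 x)) (by fun_prop) 1
    fun x => ?_, ?_, ?_, ?_⟩
  · rw [Real.norm_eq_abs, abs_le]
    exact ⟨le_max_left _ _, max_le (by norm_num) (min_le_left _ _)⟩
  · intro x y hxy
    exact max_le_max le_rfl (min_le_min le_rfl hxy)
  · intro x hx
    simp [hx]
  · intro x hx
    simp [hx]

/-- A pair of contractions `δ₁ : [-1,1] → [0,1]`, `δ₂ : [-1,1] → [-1,0]` is conjugate, through a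
monotone map, to the pair of maps `t ↦ (t + 1) / 2`, `t ↦ (t - 1) / 2`. -/
theorem exists_clampedMonotone_conjugation {K : NNReal} (hK : K < 1) {δ₁ δ₂ : ℝ → ℝ}
    (h₁ : LipschitzWith K δ₁) (h₂ : LipschitzWith K δ₂) (m₁ : Monotone δ₁) (m₂ : Monotone δ₂)
    (h₁l : δ₁ (-1) = 0) (h₁r : δ₁ 1 = 1) (h₂l : δ₂ (-1) = -1) (h₂r : δ₂ 1 = 0) :
    ∃ f ∈ clampedMonotone, ∀ x, f x = δ₁ (f (2 * x - 1)) + δ₂ (f (2 * x + 1)) := by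
  let Φ : (ℝ →ᵇ ℝ) → (ℝ →ᵇ ℝ) := fun f =>
    (f.compContinuous ⟨fun x => 2 * x - 1, by fun_prop⟩).comp δ₁ h₁ +
      (f.compContinuous ⟨fun x => 2 * x + 1, by fun_prop⟩).comp δ₂ h₂
  have hΦ (f : ℝ →ᵇ ℝ) (x : ℝ) : Φ f x = δ₁ (f (2 * x - 1)) + δ₂ (f (2 * x + 1)) := rfl
  have hmaps : MapsTo Φ clampedMonotone clampedMonotone := by
    rintro f ⟨hm, hl, hr⟩
    refine ⟨fun x y hxy => ?_, fun x hx => ?_, fun x hx => ?_⟩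
    · rw [hΦ, hΦ]
      exact add_le_add (m₁ (hm (by linarith))) (m₂ (hm (by linarith)))
    · rw [hΦ, hl _ (by linarith), hl _ (by linarith), h₁l, h₂l, zero_add]
    · rw [hΦ, hr _ (by linarith), hr _ (by linarith), h₁r, h₂r, add_zero]
  have hcontr : ContractingWith K (hmaps.restrict Φ clampedMonotone clampedMonotone) := by
    refine ⟨hK, LipschitzWith.of_dist_le_mul ?_⟩
    rintro ⟨f, -, hfl, hfr⟩ ⟨g, -, hgl, hgr⟩
    refine (dist_le (by positivity)).2 fun x => ?_
    change dist (Φ f x) (Φ g x) ≤ K * dist f g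
    rw [hΦ, hΦ]
    rcases le_total x 0 with hx | hx
    · rw [hfl (2 * x - 1) (by linarith), hgl (2 * x - 1) (by linarith), dist_add_left]
      exact (h₂.dist_le_mul _ _).trans (by gcongr; exact dist_coe_le_dist _)
    · rw [hfr (2 * x + 1) (by linarith), hgr (2 * x + 1) (by linarith), dist_add_right]
      exact (h₁.dist_le_mul _ _).trans (by gcongr; exact dist_coe_le_dist _)
  obtain ⟨f₀, hf₀⟩ := clampedMonotone_nonempty
  obtain ⟨f, hf, hfix, -⟩ := hcontr.exists_fixedPoint' isClosed_clampedMonotone.isComplete hmaps hf₀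
    (edist_ne_top _ _)
  exact ⟨f, hf, fun x => by rw [← hΦ, hfix.eq]⟩

/-- The contraction with slopes `1/4` on `[-1,0]` and `3/4` on `[0,1]`. -/
noncomputable def upperBranch (x : ℝ) : ℝ := max ((x + 1) / 4) ((3 * x + 1) / 4)

theorem upperBranch_of_nonneg {x : ℝ} (hx : 0 ≤ x) : upperBranch x = (3 * x + 1) / 4 :=
  max_eq_right (by linarith)

theorem upperBranch_of_nonpos {x : ℝ} (hx : x ≤ 0) : upperBranch x = (x + 1) / 4 :=
  max_eq_left (by linarith)

theorem upperBranch_sub_bounds {x y : ℝ} (hxy : x ≤ y) :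
    (y - x) / 4 ≤ upperBranch y - upperBranch x ∧
      upperBranch y - upperBranch x ≤ 3 / 4 * (y - x) := by
  rcases le_total x 0 with hx | hx <;> rcases le_total y 0 with hy | hy <;>
    simp only [upperBranch_of_nonneg, upperBranch_of_nonpos, hx, hy] <;>
    constructor <;> linarith

theorem monotone_upperBranch : Monotone upperBranch := fun x y hxy => by
  linarith [(upperBranch_sub_bounds hxy).1]

theorem monotone_sub_upperBranch : Monotone fun x => x - upperBranch x := fun x y hxy => by
  linarith [(upperBranch_sub_bounds hxy).2]

theorem LipschitzWith.of_monotone_of_sub_le {f : ℝ → ℝ} {K : NNReal} (hf : Monotone f)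
    (h : ∀ x y, x ≤ y → f y - f x ≤ K * (y - x)) : LipschitzWith K f := by
  refine LipschitzWith.of_dist_le_mul fun x y => ?_
  wlog hxy : x ≤ y generalizing x y
  · rw [dist_comm, dist_comm x]
    exact this y x (le_of_not_ge hxy)
  rw [dist_comm, dist_comm x, Real.dist_eq, Real.dist_eq, abs_of_nonneg (sub_nonneg.2 hxy),
    abs_of_nonneg (sub_nonneg.2 (hf hxy))]
  exact h x y hxy

/-- A monotone solution of the functional equation whose increments at `1` decay like `(3/4)^n`
on dyadic scales. -/
theorem exists_monotone_solution : ∃ f ∈ clampedMonotone, f 0 = 0 ∧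
    (∀ t ∈ Iseg, f t = f ((t + 1) / 2) + f ((t - 1) / 2)) ∧
    ∀ n : ℕ, f (1 - (1 / 2) ^ n) = 1 - (3 / 4) ^ n := by
  have h₁l : upperBranch (-1) = 0 := by norm_num [upperBranch]
  have h₁r : upperBranch 1 = 1 := by norm_num [upperBranch]
  obtain ⟨f, hf, hfix⟩ := exists_clampedMonotone_conjugation (K := 3 / 4)
    (δ₁ := upperBranch) (δ₂ := fun x => x - upperBranch x)
    (by rw [← NNReal.coe_lt_coe]; norm_num)
    (.of_monotone_of_sub_le monotone_upperBranch fun x y hxy => by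
      push_cast; exact (upperBranch_sub_bounds hxy).2)
    (.of_monotone_of_sub_le monotone_sub_upperBranch fun x y hxy => by
      push_cast; linarith [(upperBranch_sub_bounds hxy).1])
    monotone_upperBranch monotone_sub_upperBranch h₁l h₁r (by simp [h₁l]) (by simp [h₁r])
  obtain ⟨hm, hl, hr⟩ := id hf
  have h0 : f 0 = 0 := by
    rw [hfix, hl _ (by norm_num), hr _ (by norm_num), h₁l, h₁r]; norm_num
  refine ⟨f, hf, h0, fun t ht => ?_, fun n => ?_⟩
  · rw [hfix ((t + 1) / 2), hfix ((t - 1) / 2), hr (2 * ((t + 1) / 2) + 1) (by linarith [ht.1]),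
      hl (2 * ((t - 1) / 2) - 1) (by linarith [ht.2]), h₁l, h₁r]
    ring_nf
  · induction n with
    | zero => simpa using h0
    | succ n ih =>
      have hn : (1 / 2 : ℝ) ^ n ≤ 1 := pow_le_one₀ (by norm_num) (by norm_num)
      have hn' : (3 / 4 : ℝ) ^ n ≤ 1 := pow_le_one₀ (by norm_num) (by norm_num)
      rw [hfix, hr (2 * (1 - (1 / 2) ^ (n + 1)) + 1) (by rw [pow_succ]; linarith), h₁r,
        show 2 * (1 - (1 / 2 : ℝ) ^ (n + 1)) - 1 = 1 - (1 / 2) ^ n by ring, ih,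
        upperBranch_of_nonneg (by linarith)]
      ring

theorem not_differentiableWithinAt_of_dyadic_increments {h : ℝ → ℝ} {c : ℝ} (hc : 0 < c)
    (hh : ∀ n : ℕ, c * (3 / 4) ^ n ≤ h 1 - h (1 - (1 / 2) ^ n)) :
    ¬ DifferentiableWithinAt ℝ h Iseg 1 := by
  intro hd
  obtain ⟨C, hC⟩ := hd.hasFDerivWithinAt.isBigO_sub.bound
  have hpow : Tendsto (fun n : ℕ => (1 / 2 : ℝ) ^ n) atTop (𝓝 0) :=
    tendsto_pow_atTop_nhds_zero_of_lt_one (by norm_num) (by norm_num)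
  have hlim : Tendsto (fun n : ℕ => 1 - (1 / 2 : ℝ) ^ n) atTop (𝓝[Iseg] 1) := by
    refine tendsto_nhdsWithin_iff.2 ⟨by simpa using hpow.const_sub 1, .of_forall fun n => ?_⟩
    have h1 : (1 / 2 : ℝ) ^ n ≤ 1 := pow_le_one₀ (by norm_num) (by norm_num)
    have h2 : (0 : ℝ) < (1 / 2) ^ n := by positivity
    exact ⟨by linarith, by linarith⟩
  have hgrow : Tendsto (fun n : ℕ => c * (3 / 2 : ℝ) ^ n) atTop atTop :=
    (tendsto_pow_atTop_atTop_of_one_lt (by norm_num)).const_mul_atTop hc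
  obtain ⟨n, hn, hn'⟩ := ((hlim.eventually hC).and (hgrow.eventually_gt_atTop C)).exists
  have h2 : (0 : ℝ) < (1 / 2) ^ n := by positivity
  rw [norm_sub_rev, sub_sub_cancel_left, norm_neg, Real.norm_of_nonneg h2.le] at hn
  have hle : c * (3 / 4) ^ n ≤ C * (1 / 2) ^ n := (hh n).trans ((le_abs_self _).trans hn)
  rw [show (3 / 4 : ℝ) = 3 / 2 * (1 / 2) by norm_num, mul_pow, ← mul_assoc] at hle
  exact hn'.not_ge (le_of_mul_le_mul_right hle h2)

theorem OrderIso.isHomeoOfIcc (e : ℝ ≃o ℝ) (hl : e (-1) = -1) (hr : e 1 = 1) :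
    IsHomeoOfIcc e ∧ BijOn e Iseg Iseg := by
  have hm : MapsTo e Iseg Iseg := fun t ht =>
    ⟨hl ▸ e.monotone ht.1, (e.monotone ht.2).trans_eq hr⟩
  have hm' : MapsTo e.symm Iseg Iseg := fun t ht =>
    ⟨e.le_symm_apply.2 (hl.trans_le ht.1), e.symm_apply_le.2 (ht.2.trans_eq hr.symm)⟩
  exact ⟨⟨e.continuous.continuousOn, hm, e.symm, e.symm.continuous.continuousOn, hm',
    fun t _ => e.symm_apply_apply t, fun t _ => e.apply_symm_apply t⟩,
    hm, e.injective.injOn, fun t ht => ⟨e.symm t, hm' ht, e.apply_symm_apply t⟩⟩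

/-- There is a strictly increasing homeomorphism `h` of `[-1,1]` onto itself, fixing
`-1, 0, 1`, solving `h(t) = h((t+1)/2) + h((t-1)/2)`, which is not continuously
differentiable (in particular not the identity and not linear). -/
theorem exists_nonsmooth_increasing_solution :
    ∃ h : ℝ → ℝ, StrictMonoOn h Iseg ∧ IsHomeoOfIcc h ∧ BijOn h Iseg Iseg ∧
      h (-1) = -1 ∧ h 0 = 0 ∧ h 1 = 1 ∧
      (∀ t ∈ Iseg, h t = h ((t + 1) / 2) + h ((t - 1) / 2)) ∧
      ¬ ContDiffOn ℝ 1 h Iseg ∧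
      ¬ EqOn h id Iseg ∧
      ¬ ∃ c : ℝ, ∀ z ∈ Iseg, h z = c * z := by
  obtain ⟨f, ⟨hm, hl, hr⟩, h0, hfun, hdy⟩ := exists_monotone_solution
  let H : ℝ → ℝ := fun t => (t + f t) / 2
  have hH : StrictMono H := fun x y hxy => by
    have := hm hxy.le
    simp only [H]
    linarith
  have hcont : Continuous H := by fun_prop
  have hsurj : Function.Surjective H := by
    have htop : Tendsto (fun x : ℝ => (x + -1) / 2) atTop atTop :=
      (tendsto_atTop_add_const_right _ _ tendsto_id).atTop_div_const two_pos
    have hbot : Tendsto (fun x : ℝ => (x + 1) / 2) atBot atBot :=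
      (tendsto_atBot_add_const_right _ _ tendsto_id).atBot_div_const two_pos
    refine hcont.surjective (tendsto_atTop_mono' _ ?_ htop) (tendsto_atBot_mono' _ ?_ hbot)
    · filter_upwards [eventually_ge_atTop 1] with x hx
      simp only [H, hr x hx]
      linarith
    · filter_upwards [eventually_le_atBot (-1)] with x hx
      simp only [H, hl x hx]
      linarith
  have hl' : H (-1) = -1 := by norm_num [H, hl (-1) le_rfl]
  have hr' : H 1 = 1 := by norm_num [H, hr 1 le_rfl]
  obtain ⟨hhomeo, hbij⟩ := OrderIso.isHomeoOfIcc (hH.orderIsoOfSurjective H hsurj) hl' hr'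
  have hone : (1 : ℝ) ∈ Iseg := ⟨by norm_num, le_rfl⟩
  have hnd : ¬ DifferentiableWithinAt ℝ H Iseg 1 := by
    refine not_differentiableWithinAt_of_dyadic_increments (c := 1 / 2) (by norm_num) fun n => ?_
    have : (0 : ℝ) < (1 / 2) ^ n := by positivity
    simp only [H, hdy, hr 1 le_rfl]
    linarith
  have hlin : ¬ ∃ c : ℝ, ∀ z ∈ Iseg, H z = c * z := fun ⟨c, hc⟩ =>
    hnd ((differentiableWithinAt_id.const_mul c).congr hc (hc 1 hone))
  refine ⟨H, hH.strictMonoOn _, hhomeo, hbij, hl', by simp [H, h0], hr', fun t ht => ?_,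
    fun h => hnd (h.differentiableOn one_ne_zero 1 hone),
    fun h => hlin ⟨1, fun z hz => by simpa using h hz⟩, hlin⟩
  simp only [H]
  rw [hfun t ht]
  ring
end

section
/- For every pair of distinct natural numbers n ≠ k there exist P-configurations (δ₁, δ₂) and (σ₁, σ₂) in I = [-1,1] and points λ, ω ∈ I with the following properties: δ₂'(t) > 0 and σ₂'(t) > 0 for all t ∈ I; δ₁'(t) = 0 exactly when t = λ, and λ lies in the interior of Jₙ = [1 - 2⁻ⁿ, 1 - 2⁻⁽ⁿ⁺¹⁾]; σ₁'(t) = 0 exactly when t = ω, and ω lies in the interior of J_k = [1 - 2⁻ᵏ, 1 - 2⁻⁽ᵏ⁺¹⁾]; and no homeomorphism h : I → I satisfies both h(δᵢ(t)) = σᵢ(h(t)) for i = 1,2 and all t ∈ I, and h(λ) = ω. In particular there are infinitely many pairwise non-isomorphic P-configurations whose guiding set Λ₂ is empty and whose guiding set Λ₁ is a single point. -/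
open Set

/-- `δ₁, δ₂ : I → I` (with derivative functions `d₁, d₂` on `I`) form a *P-configuration*
in `I = [-1,1]`: they are `C¹`, `d₁ + d₂ = 1`, both derivatives are nonnegative, and the
endpoint conditions hold. -/
structure PConfig (δ₁ δ₂ d₁ d₂ : ℝ → ℝ) : Prop where
  maps₁ : MapsTo δ₁ Iseg Iseg
  maps₂ : MapsTo δ₂ Iseg Iseg
  hasDeriv₁ : ∀ t ∈ Iseg, HasDerivWithinAt δ₁ (d₁ t) Iseg t
  hasDeriv₂ : ∀ t ∈ Iseg, HasDerivWithinAt δ₂ (d₂ t) Iseg t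
  contDeriv₁ : ContinuousOn d₁ Iseg
  contDeriv₂ : ContinuousOn d₂ Iseg
  derivSum : ∀ t ∈ Iseg, d₁ t + d₂ t = 1
  derivNonneg₁ : ∀ t ∈ Iseg, 0 ≤ d₁ t
  derivNonneg₂ : ∀ t ∈ Iseg, 0 ≤ d₂ t
  fix₂ : δ₂ (-1) = -1
  mid₂ : δ₂ 1 = 0
  mid₁ : δ₁ (-1) = 0
  fix₁ : δ₁ 1 = 1

/-- A primitive of the positive part `max x 0`. -/
noncomputable def halfSqPos (x : ℝ) : ℝ := max x 0 ^ 2 / 2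

theorem hasDerivAt_halfSqPos (x : ℝ) : HasDerivAt halfSqPos (max x 0) x := by
  unfold halfSqPos
  rcases lt_trichotomy x 0 with hx | rfl | hx
  · rw [max_eq_right hx.le]
    refine (hasDerivAt_const x (0 : ℝ)).congr_of_eventuallyEq ?_
    filter_upwards [Iio_mem_nhds hx] with y hy
    simp [max_eq_right (le_of_lt (mem_Iio.1 hy))]
  · rw [max_self, hasDerivAt_iff_isLittleO]
    have hsq : (fun y : ℝ => y ^ 2) =o[nhds 0] fun y => y := by
      simpa using Asymptotics.isLittleO_pow_pow (𝕜 := ℝ) (show 1 < 2 by norm_num)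
    refine Asymptotics.IsBigO.trans_isLittleO (g := fun y : ℝ => y ^ 2) ?_ (by simpa using hsq)
    refine Asymptotics.IsBigO.of_bound 1 (Filter.Eventually.of_forall fun y => ?_)
    rcases le_total y 0 with hy | hy
    · simp [max_eq_right hy]
      positivity
    · simp [max_eq_left hy]
      nlinarith [sq_nonneg y]
  · rw [max_eq_left hx.le]
    have h : HasDerivAt (fun y : ℝ => y ^ 2 / 2) x x := by
      simpa using (hasDerivAt_pow 2 x).div_const 2
    refine h.congr_of_eventuallyEq ?_
    filter_upwards [Ioi_mem_nhds hx] with y hy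
    simp [max_eq_left (le_of_lt (mem_Ioi.1 hy))]

/-- A piecewise linear function supported in `[0, 6]` with mean zero, attaining its minimum `-1`
only at `1` and bounded above by `1 / 2`. -/
noncomputable def zigzag (u : ℝ) : ℝ :=
  -max u 0 + 2 * max (u - 1) 0 - 8 / 7 * max (u - 5 / 2) 0 + 1 / 7 * max (u - 6) 0

/-- The compactly supported primitive of `zigzag`. -/
noncomputable def zigzagPrim (u : ℝ) : ℝ :=
  -halfSqPos u + 2 * halfSqPos (u - 1) - 8 / 7 * halfSqPos (u - 5 / 2) +
    1 / 7 * halfSqPos (u - 6)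

theorem hasDerivAt_zigzagPrim (u : ℝ) : HasDerivAt zigzagPrim (zigzag u) u := by
  have h (c : ℝ) : HasDerivAt (fun x => halfSqPos (x - c)) (max (u - c) 0) u := by
    simpa using (hasDerivAt_halfSqPos (u - c)).comp_sub_const u c
  exact (((hasDerivAt_halfSqPos u).neg.add ((h 1).const_mul 2)).sub
    ((h (5 / 2)).const_mul (8 / 7))).add ((h 6).const_mul (1 / 7))

theorem continuous_zigzag : Continuous zigzag := by
  unfold zigzag
  fun_prop

theorem neg_one_le_zigzag (u : ℝ) : -1 ≤ zigzag u := by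
  unfold zigzag
  rcases max_cases u 0 with h₀ | h₀ <;> rcases max_cases (u - 1) 0 with h₁ | h₁ <;>
    rcases max_cases (u - 5 / 2) 0 with h₂ | h₂ <;>
    rcases max_cases (u - 6) 0 with h₃ | h₃ <;> linarith

theorem zigzag_le_half (u : ℝ) : zigzag u ≤ 1 / 2 := by
  unfold zigzag
  rcases max_cases u 0 with h₀ | h₀ <;> rcases max_cases (u - 1) 0 with h₁ | h₁ <;>
    rcases max_cases (u - 5 / 2) 0 with h₂ | h₂ <;>
    rcases max_cases (u - 6) 0 with h₃ | h₃ <;> linarith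

theorem zigzag_eq_neg_one_iff {u : ℝ} : zigzag u = -1 ↔ u = 1 := by
  constructor
  · unfold zigzag
    intro hu
    rcases max_cases u 0 with h₀ | h₀ <;> rcases max_cases (u - 1) 0 with h₁ | h₁ <;>
      rcases max_cases (u - 5 / 2) 0 with h₂ | h₂ <;>
      rcases max_cases (u - 6) 0 with h₃ | h₃ <;> linarith
  · rintro rfl
    norm_num [zigzag]

theorem zigzagPrim_of_nonpos {u : ℝ} (hu : u ≤ 0) : zigzagPrim u = 0 := by
  unfold zigzagPrim halfSqPos
  rw [max_eq_right hu, max_eq_right (by linarith), max_eq_right (by linarith),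
    max_eq_right (by linarith)]
  ring

theorem zigzagPrim_of_six_le {u : ℝ} (hu : 6 ≤ u) : zigzagPrim u = 0 := by
  unfold zigzagPrim halfSqPos
  rw [max_eq_left (by linarith), max_eq_left (by linarith), max_eq_left (by linarith),
    max_eq_left (by linarith)]
  ring

theorem zigzagPrim_nonpos (u : ℝ) : zigzagPrim u ≤ 0 := by
  rcases le_total 6 u with h6 | h6
  · exact (zigzagPrim_of_six_le h6).le
  unfold zigzagPrim halfSqPos
  rw [max_eq_right (show u - 6 ≤ 0 by linarith)]
  rcases max_cases u 0 with h₀ | h₀ <;> rcases max_cases (u - 1) 0 with h₁ | h₁ <;>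
    rcases max_cases (u - 5 / 2) 0 with h₂ | h₂ <;> rw [h₀.1, h₁.1, h₂.1] <;> nlinarith

theorem neg_one_le_zigzagPrim (u : ℝ) : -1 ≤ zigzagPrim u := by
  rcases le_total 6 u with h6 | h6
  · rw [zigzagPrim_of_six_le h6]
    norm_num
  unfold zigzagPrim halfSqPos
  rw [max_eq_right (show u - 6 ≤ 0 by linarith)]
  rcases max_cases u 0 with h₀ | h₀ <;> rcases max_cases (u - 1) 0 with h₁ | h₁ <;>
    rcases max_cases (u - 5 / 2) 0 with h₂ | h₂ <;> rw [h₀.1, h₁.1, h₂.1] <;>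
    nlinarith [sq_nonneg (u - 2)]

/-- The coordinate mapping `[1 - 2⁻ⁿ, 1 - 2⁻⁽ⁿ⁺¹⁾]` affinely onto `[0, 6]`. -/
noncomputable def dyadicCoord (n : ℕ) (t : ℝ) : ℝ :=
  (t - (1 - (1 / 2 : ℝ) ^ n)) / ((1 / 2 : ℝ) ^ n / 12)

/-- The map `t ↦ (t + 1) / 2`, modified inside `[1 - 2⁻ⁿ, 1 - 2⁻⁽ⁿ⁺¹⁾]` to have a single critical
point. -/
noncomputable def bentHalf (n : ℕ) (t : ℝ) : ℝ :=
  (t + 1) / 2 + (1 / 2 : ℝ) ^ n / 24 * zigzagPrim (dyadicCoord n t)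

/-- The derivative of `bentHalf n`. -/
noncomputable def bentHalfDeriv (n : ℕ) (t : ℝ) : ℝ :=
  1 / 2 + zigzag (dyadicCoord n t) / 2

/-- The critical point of `bentHalf n`. -/
noncomputable def bentCrit (n : ℕ) : ℝ := 1 - 11 / 12 * (1 / 2 : ℝ) ^ n

theorem hasDerivAt_bentHalf (n : ℕ) (t : ℝ) :
    HasDerivAt (bentHalf n) (bentHalfDeriv n t) t := by
  have hc : HasDerivAt (dyadicCoord n) (1 / ((1 / 2 : ℝ) ^ n / 12)) t :=
    ((hasDerivAt_id t).sub_const _).div_const _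
  have h := (((hasDerivAt_id t).add_const 1).div_const 2).add
    (((hasDerivAt_zigzagPrim (dyadicCoord n t)).comp t hc).const_mul ((1 / 2 : ℝ) ^ n / 24))
  refine h.congr_deriv ?_
  have hp : (1 / 2 : ℝ) ^ n ≠ 0 := by positivity
  unfold bentHalfDeriv
  field_simp
  ring

theorem continuous_bentHalfDeriv (n : ℕ) : Continuous (bentHalfDeriv n) := by
  have h : Continuous (dyadicCoord n) := by
    unfold dyadicCoord
    fun_prop
  exact continuous_const.add ((continuous_zigzag.comp h).div_const 2)

theorem bentHalfDeriv_nonneg (n : ℕ) (t : ℝ) : 0 ≤ bentHalfDeriv n t := by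
  unfold bentHalfDeriv
  linarith [neg_one_le_zigzag (dyadicCoord n t)]

theorem bentHalfDeriv_lt_one (n : ℕ) (t : ℝ) : bentHalfDeriv n t < 1 := by
  unfold bentHalfDeriv
  linarith [zigzag_le_half (dyadicCoord n t)]

theorem bentHalfDeriv_eq_zero_iff {n : ℕ} {t : ℝ} : bentHalfDeriv n t = 0 ↔ t = bentCrit n := by
  have hp : (0 : ℝ) < (1 / 2 : ℝ) ^ n := by positivity
  have h : bentHalfDeriv n t = 0 ↔ zigzag (dyadicCoord n t) = -1 := by
    unfold bentHalfDeriv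
    constructor <;> intro h <;> linarith
  rw [h, zigzag_eq_neg_one_iff, dyadicCoord, div_eq_one_iff_eq (by positivity), bentCrit]
  constructor <;> intro h <;> linarith

theorem bentCrit_mem_Ioo (n : ℕ) :
    bentCrit n ∈ Ioo (1 - (1 / 2 : ℝ) ^ n) (1 - (1 / 2 : ℝ) ^ (n + 1)) := by
  have hp : (0 : ℝ) < (1 / 2 : ℝ) ^ n := by positivity
  rw [bentCrit, pow_succ]
  constructor <;> linarith

theorem bentHalf_of_le {n : ℕ} {t : ℝ} (ht : t ≤ 1 - (1 / 2 : ℝ) ^ n) :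
    bentHalf n t = (t + 1) / 2 := by
  rw [bentHalf, zigzagPrim_of_nonpos, mul_zero, add_zero]
  exact div_nonpos_of_nonpos_of_nonneg (by linarith) (by positivity)

theorem bentHalf_of_ge {n : ℕ} {t : ℝ} (ht : 1 - (1 / 2 : ℝ) ^ (n + 1) ≤ t) :
    bentHalf n t = (t + 1) / 2 := by
  rw [bentHalf, zigzagPrim_of_six_le, mul_zero, add_zero]
  rw [dyadicCoord, le_div_iff₀ (by positivity)]
  rw [pow_succ] at ht
  linarith

theorem bentHalf_dyadic (n j : ℕ) :
    bentHalf n (1 - (1 / 2 : ℝ) ^ j) = 1 - (1 / 2 : ℝ) ^ (j + 1) := by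
  have h : (1 - (1 / 2 : ℝ) ^ j + 1) / 2 = 1 - (1 / 2 : ℝ) ^ (j + 1) := by ring
  rw [← h]
  rcases le_or_gt j n with hj | hj
  · exact bentHalf_of_le (by
      linarith [pow_le_pow_of_le_one (by norm_num : (0 : ℝ) ≤ 1 / 2) (by norm_num) hj])
  · have hpow : (1 / 2 : ℝ) ^ j ≤ (1 / 2 : ℝ) ^ (n + 1) :=
      pow_le_pow_of_le_one (by norm_num) (by norm_num) hj
    exact bentHalf_of_ge (by linarith)

theorem bentHalf_neg_one (n : ℕ) : bentHalf n (-1) = 0 := by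
  have hp : (1 / 2 : ℝ) ^ n ≤ 1 := pow_le_one₀ (by norm_num) (by norm_num)
  rw [bentHalf_of_le (by linarith)]
  norm_num

theorem bentHalf_one (n : ℕ) : bentHalf n 1 = 1 := by
  rw [bentHalf_of_ge (by linarith [show (0 : ℝ) < (1 / 2 : ℝ) ^ (n + 1) by positivity])]
  norm_num

theorem bentHalf_le (n : ℕ) (t : ℝ) : bentHalf n t ≤ (t + 1) / 2 := by
  unfold bentHalf
  nlinarith [zigzagPrim_nonpos (dyadicCoord n t), show (0 : ℝ) < (1 / 2 : ℝ) ^ n by positivity]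

theorem le_bentHalf (n : ℕ) (t : ℝ) : (t + 1) / 2 - 1 / 24 ≤ bentHalf n t := by
  have hp : (1 / 2 : ℝ) ^ n ≤ 1 := pow_le_one₀ (by norm_num) (by norm_num)
  unfold bentHalf
  nlinarith [neg_one_le_zigzagPrim (dyadicCoord n t), show (0 : ℝ) < (1 / 2 : ℝ) ^ n by positivity]

theorem bentHalf_pos {n : ℕ} {t : ℝ} (ht : -1 < t) : 0 < bentHalf n t := by
  rcases le_total t (1 - (1 / 2 : ℝ) ^ n) with h | h
  · rw [bentHalf_of_le h]
    linarith
  · have hp : (1 / 2 : ℝ) ^ n ≤ 1 := pow_le_one₀ (by norm_num) (by norm_num)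
    linarith [le_bentHalf n t]

theorem pConfig_bentHalf (n : ℕ) :
    PConfig (bentHalf n) (fun t => t - bentHalf n t) (bentHalfDeriv n)
      (fun t => 1 - bentHalfDeriv n t) where
  maps₁ t ht := ⟨by linarith [le_bentHalf n t, ht.1], by linarith [bentHalf_le n t, ht.2]⟩
  maps₂ t ht := ⟨by linarith [bentHalf_le n t, ht.1], by linarith [le_bentHalf n t, ht.2]⟩
  hasDeriv₁ t _ := (hasDerivAt_bentHalf n t).hasDerivWithinAt
  hasDeriv₂ t _ := ((hasDerivAt_id t).sub (hasDerivAt_bentHalf n t)).hasDerivWithinAt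
  contDeriv₁ := (continuous_bentHalfDeriv n).continuousOn
  contDeriv₂ := (continuous_const.sub (continuous_bentHalfDeriv n)).continuousOn
  derivSum t _ := by ring
  derivNonneg₁ t _ := bentHalfDeriv_nonneg n t
  derivNonneg₂ t _ := by linarith [bentHalfDeriv_lt_one n t]
  fix₂ := by simp [bentHalf_neg_one]
  mid₂ := by simp [bentHalf_one]
  mid₁ := bentHalf_neg_one n
  fix₁ := bentHalf_one n

theorem IsHomeoOfIcc.strictMonoOn {h : ℝ → ℝ} (hh : IsHomeoOfIcc h) (h₀ : h (-1) = -1) :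
    StrictMonoOn h Iseg := by
  obtain ⟨hc, hm, g, -, -, hgh, -⟩ := hh
  have hinj : InjOn h Iseg := fun x hx y hy hxy => by rw [← hgh x hx, ← hgh y hy, hxy]
  refine ContinuousOn.strictMonoOn_of_injOn_Icc (by norm_num) ?_ hc hinj
  rw [h₀]
  exact (hm ⟨by norm_num, le_rfl⟩).1

theorem IsHomeoOfIcc.map_one {h : ℝ → ℝ} (hh : IsHomeoOfIcc h) (h₀ : h (-1) = -1) :
    h 1 = 1 := by
  have hmono := hh.strictMonoOn h₀
  obtain ⟨-, hm, g, -, hgm, -, hhg⟩ := hh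
  have h1 : (1 : ℝ) ∈ Iseg := ⟨by norm_num, le_rfl⟩
  refine le_antisymm (hm h1).2 ?_
  calc (1 : ℝ) = h (g 1) := (hhg 1 h1).symm
    _ ≤ h 1 := hmono.monotoneOn (hgm h1) h1 (hgm h1).2

theorem dyadic_mem_Iseg (j : ℕ) : 1 - (1 / 2 : ℝ) ^ j ∈ Iseg := by
  have hle : (1 / 2 : ℝ) ^ j ≤ 1 := pow_le_one₀ (by norm_num) (by norm_num)
  have hpos : (0 : ℝ) < (1 / 2 : ℝ) ^ j := by positivity
  exact ⟨by linarith, by linarith⟩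

theorem bentCrit_mem_Iseg (n : ℕ) : bentCrit n ∈ Iseg :=
  ⟨((dyadic_mem_Iseg n).1.trans_lt (bentCrit_mem_Ioo n).1).le,
    ((bentCrit_mem_Ioo n).2.trans_le (dyadic_mem_Iseg (n + 1)).2).le⟩

theorem map_dyadic_of_conj {n k : ℕ} {h : ℝ → ℝ} (h0 : h 0 = 0)
    (hconj : ∀ t ∈ Iseg, h (bentHalf n t) = bentHalf k (h t)) (j : ℕ) :
    h (1 - (1 / 2 : ℝ) ^ j) = 1 - (1 / 2 : ℝ) ^ j := by
  induction j with
  | zero => simpa using h0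
  | succ j ih => rw [← bentHalf_dyadic n j, hconj _ (dyadic_mem_Iseg j), ih, bentHalf_dyadic,
      bentHalf_dyadic]

theorem eq_of_mem_Ioo_dyadic {n k : ℕ} {x : ℝ}
    (hn : x ∈ Ioo (1 - (1 / 2 : ℝ) ^ n) (1 - (1 / 2 : ℝ) ^ (n + 1)))
    (hk : x ∈ Ioo (1 - (1 / 2 : ℝ) ^ k) (1 - (1 / 2 : ℝ) ^ (k + 1))) : n = k := by
  have key {a b : ℕ} (ha : x < 1 - (1 / 2 : ℝ) ^ (a + 1)) (hb : 1 - (1 / 2 : ℝ) ^ b < x) :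
      b ≤ a := by
    have h : (1 / 2 : ℝ) ^ (a + 1) < (1 / 2 : ℝ) ^ b := by linarith
    exact Nat.lt_succ_iff.1 ((pow_lt_pow_iff_right_of_lt_one₀ (by norm_num) (by norm_num)).1 h)
  exact le_antisymm (key hk.2 hn.1) (key hn.2 hk.1)

/-- For distinct `n ≠ k` there are P-configurations `(δ₁, δ₂)` and `(σ₁, σ₂)` whose guiding
sets `Λ₂` are empty and whose guiding sets `Λ₁` are singletons `{λ}` and `{ω}` lying in the
interiors of `Jₙ` and `J_k` respectively, such that no homeomorphism of `I` intertwining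
the two systems maps `λ` to `ω`; hence there are infinitely many pairwise non-isomorphic
such P-configurations. -/
theorem nonisomorphic_singleton_pconfigs (n k : ℕ) (hnk : n ≠ k) :
    ∃ (δ₁ δ₂ d₁ d₂ σ₁ σ₂ e₁ e₂ : ℝ → ℝ) (lam om : ℝ),
      PConfig δ₁ δ₂ d₁ d₂ ∧ PConfig σ₁ σ₂ e₁ e₂ ∧
      (∀ t ∈ Iseg, 0 < d₂ t) ∧ (∀ t ∈ Iseg, 0 < e₂ t) ∧
      (∀ t ∈ Iseg, (d₁ t = 0 ↔ t = lam)) ∧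
      lam ∈ Ioo (1 - (1 / 2 : ℝ) ^ n) (1 - (1 / 2 : ℝ) ^ (n + 1)) ∧
      (∀ t ∈ Iseg, (e₁ t = 0 ↔ t = om)) ∧
      om ∈ Ioo (1 - (1 / 2 : ℝ) ^ k) (1 - (1 / 2 : ℝ) ^ (k + 1)) ∧
      ¬ ∃ h : ℝ → ℝ, IsHomeoOfIcc h ∧
          (∀ t ∈ Iseg, h (δ₁ t) = σ₁ (h t)) ∧ (∀ t ∈ Iseg, h (δ₂ t) = σ₂ (h t)) ∧
          h lam = om := by
  refine ⟨bentHalf n, fun t => t - bentHalf n t, bentHalfDeriv n, fun t => 1 - bentHalfDeriv n t,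
    bentHalf k, fun t => t - bentHalf k t, bentHalfDeriv k, fun t => 1 - bentHalfDeriv k t,
    bentCrit n, bentCrit k, pConfig_bentHalf n, pConfig_bentHalf k,
    fun t _ => sub_pos.2 (bentHalfDeriv_lt_one n t),
    fun t _ => sub_pos.2 (bentHalfDeriv_lt_one k t),
    fun t _ => bentHalfDeriv_eq_zero_iff, bentCrit_mem_Ioo n,
    fun t _ => bentHalfDeriv_eq_zero_iff, bentCrit_mem_Ioo k, ?_⟩
  rintro ⟨h, hh, hconj₁, hconj₂, hcrit⟩
  have hneg : (-1 : ℝ) ∈ Iseg := ⟨le_rfl, by norm_num⟩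
  have h₀ : h (-1) = -1 := by
    by_contra hne
    have hpos := bentHalf_pos (n := k) (lt_of_le_of_ne (hh.2.1 hneg).1 (Ne.symm hne))
    have hfix := hconj₂ (-1) hneg
    simp only [bentHalf_neg_one, sub_zero] at hfix
    linarith
  have h0 : h 0 = 0 := by
    have hmid := hconj₂ 1 ⟨by norm_num, le_rfl⟩
    simpa [bentHalf_one, hh.map_one h₀] using hmid
  have hmono := hh.strictMonoOn h₀
  have hdy := map_dyadic_of_conj h0 hconj₁
  refine hnk (eq_of_mem_Ioo_dyadic (x := h (bentCrit n)) ⟨?_, ?_⟩ (hcrit ▸ bentCrit_mem_Ioo k))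
  · rw [← hdy n]
    exact hmono (dyadic_mem_Iseg n) (bentCrit_mem_Iseg n) (bentCrit_mem_Ioo n).1
  · rw [← hdy (n + 1)]
    exact hmono (bentCrit_mem_Iseg n) (dyadic_mem_Iseg (n + 1)) (bentCrit_mem_Ioo n).2
end

section
/- Let f : [-1,1] → ℝ be continuous and satisfy f(x + y) = f(x) + f(y) for all real x, y with |x| + |y| ≤ 1. Then there exists c ∈ ℝ such that f(t) = c·t for all t ∈ [-1,1]. -/
open Set

/-- A solution of the restricted Cauchy equation commutes with multiplication by `k`
as long as the multiples stay in `[-1, 1]`. -/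
theorem map_nat_mul_of_cauchy_on_square {f : ℝ → ℝ}
    (heq : ∀ x y : ℝ, |x| + |y| ≤ 1 → f (x + y) = f x + f y) (x : ℝ) (k : ℕ)
    (hk : k * |x| ≤ 1) : f (k * x) = k * f x := by
  induction k with
  | zero => simpa using heq 0 0 (by simp)
  | succ k ih =>
    push_cast at hk ⊢
    have h := heq (k * x) x (by rw [abs_mul, Nat.abs_cast]; linarith)
    rw [ih (by nlinarith [abs_nonneg x])] at h
    rw [add_one_mul, h]
    ring

/-- A solution of the restricted Cauchy equation is odd on `[-1, 1]`. -/
theorem map_neg_of_cauchy_on_square {f : ℝ → ℝ}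
    (heq : ∀ x y : ℝ, |x| + |y| ≤ 1 → f (x + y) = f x + f y) {x : ℝ} (hx : |x| ≤ 1) :
    f (-x) = -f x := by
  have hhalf : |x / 2| = |x| / 2 := by simp [abs_div]
  have h0 : f 0 = 0 := by simpa using heq 0 0 (by simp)
  have h1 := heq (x / 2) (x / 2) (by linarith)
  have h2 := heq (-(x / 2)) (-(x / 2)) (by rw [abs_neg]; linarith)
  have h3 := heq (x / 2) (-(x / 2)) (by rw [abs_neg]; linarith)
  rw [add_halves] at h1
  rw [← neg_add, add_halves] at h2
  rw [add_neg_cancel] at h3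
  linarith

/-- A continuous solution of the restricted Cauchy equation is linear on `[0, 1]`. -/
theorem eq_mul_of_cauchy_on_square_of_nonneg {f : ℝ → ℝ} (hf : ContinuousOn f Iseg)
    (heq : ∀ x y : ℝ, |x| + |y| ≤ 1 → f (x + y) = f x + f y) {t : ℝ} (h0 : 0 ≤ t)
    (h1 : t ≤ 1) : f t = f 1 * t := by
  have hlim := (tendsto_nat_floor_mul_div_atTop h0).comp
    (tendsto_natCast_atTop_atTop (R := ℝ))
  have hmem : ∀ n : ℕ, ((⌊t * n⌋₊ : ℝ) / n) ∈ Iseg := fun n ↦ by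
    have hle : (⌊t * n⌋₊ : ℝ) ≤ n :=
      (Nat.floor_le (by positivity)).trans (mul_le_of_le_one_left (by positivity) h1)
    have hnonneg : (0 : ℝ) ≤ (⌊t * n⌋₊ : ℝ) / n := by positivity
    exact ⟨by linarith, div_le_one_of_le₀ hle (by positivity)⟩
  have hft := (hf t ⟨by linarith, h1⟩).tendsto.comp
    (tendsto_nhdsWithin_iff.2 ⟨hlim, .of_forall hmem⟩)
  refine tendsto_nhds_unique hft ((hlim.const_mul (f 1)).congr' ?_)
  filter_upwards [Filter.eventually_gt_atTop 0] with n hn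
  have hn' : (0 : ℝ) < n := by exact_mod_cast hn
  have habs : |(1 / n : ℝ)| = 1 / n := abs_of_pos (by positivity)
  have hone := map_nat_mul_of_cauchy_on_square heq (1 / n) n
    (by rw [habs, mul_one_div_cancel hn'.ne'])
  have hfloor := map_nat_mul_of_cauchy_on_square heq (1 / n) ⌊t * n⌋₊
    (by rw [habs, mul_one_div]; exact (hmem n).2)
  rw [mul_one_div_cancel hn'.ne'] at hone
  rw [mul_one_div] at hfloor
  simp only [Function.comp_apply]
  rw [hfloor, hone]
  field_simp

/-- A continuous solution of the Cauchy equation restricted to the square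
`K = {(x,y) : |x| + |y| ≤ 1}` is linear. -/
theorem cauchy_on_square_linear (f : ℝ → ℝ)
    (hf : ContinuousOn f Iseg)
    (heq : ∀ x y : ℝ, |x| + |y| ≤ 1 → f (x + y) = f x + f y) :
    ∃ c : ℝ, ∀ t ∈ Iseg, f t = c * t := by
  refine ⟨f 1, fun t ⟨hl, hr⟩ ↦ ?_⟩
  rcases le_total 0 t with h0 | h0
  · exact eq_mul_of_cauchy_on_square_of_nonneg hf heq h0 hr
  · have h := eq_mul_of_cauchy_on_square_of_nonneg hf heq (t := -t) (by linarith) (by linarith)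
    rw [map_neg_of_cauchy_on_square heq (abs_le.2 ⟨hl, hr⟩)] at h
    linarith
end

section
/- Let f : [-1,1] → ℝ be continuous and satisfy f(x + y) = f(x) + f(y) for all real x, y with |x| + |y| = 1. Then there exists c ∈ ℝ such that f(t) = c·t for all t ∈ [-1,1]. -/
open Set

/-- A continuous solution of the Cauchy equation restricted to the boundary of the square
`K = {(x,y) : |x| + |y| ≤ 1}` is linear. -/
theorem cauchy_on_boundary_linear (f : ℝ → ℝ)
    (hf : ContinuousOn f Iseg)
    (heq : ∀ x y : ℝ, |x| + |y| = 1 → f (x + y) = f x + f y) :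
    ∃ c : ℝ, ∀ t ∈ Iseg, f t = c * t := by
  have half_mem : ∀ t ∈ Iseg, 0 ≤ (1 + t) / 2 ∧ 0 ≤ (1 - t) / 2 := by
    rintro t ⟨h₁, h₂⟩
    constructor <;> linarith
  have sum_one : ∀ t ∈ Iseg, f 1 = f ((1 + t) / 2) + f ((1 - t) / 2) := by
    intro t ht
    obtain ⟨h₁, h₂⟩ := half_mem t ht
    have h := heq ((1 + t) / 2) ((1 - t) / 2) (by rw [abs_of_nonneg h₁, abs_of_nonneg h₂]; ring)
    rwa [show (1 + t) / 2 + (1 - t) / 2 = 1 by ring] at h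
  have sum_neg_one : ∀ t ∈ Iseg, f (-1) = f (-((1 + t) / 2)) + f (-((1 - t) / 2)) := by
    intro t ht
    obtain ⟨h₁, h₂⟩ := half_mem t ht
    have h := heq (-((1 + t) / 2)) (-((1 - t) / 2))
      (by rw [abs_neg, abs_neg, abs_of_nonneg h₁, abs_of_nonneg h₂]; ring)
    rwa [show -((1 + t) / 2) + -((1 - t) / 2) = -1 by ring] at h
  have sum_mixed : ∀ t ∈ Iseg, f t = f ((1 + t) / 2) + f (-((1 - t) / 2)) := by
    intro t ht
    obtain ⟨h₁, h₂⟩ := half_mem t ht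
    have h := heq ((1 + t) / 2) (-((1 - t) / 2))
      (by rw [abs_neg, abs_of_nonneg h₁, abs_of_nonneg h₂]; ring)
    rwa [show (1 + t) / 2 + -((1 - t) / 2) = t by ring] at h
  have neg_mem : ∀ t ∈ Iseg, -t ∈ Iseg := fun t ht => ⟨neg_le_neg ht.2, neg_le.1 ht.1⟩
  have add_neg_const : ∀ t ∈ Iseg, f t + f (-t) = f 1 + f (-1) := by
    intro t ht
    have h := sum_mixed (-t) (neg_mem t ht)
    rw [← sub_eq_add_neg, sub_neg_eq_add] at h
    linarith [sum_mixed t ht, sum_one t ht, sum_neg_one t ht]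
  have zero_mem : (0 : ℝ) ∈ Iseg := ⟨by norm_num, by norm_num⟩
  have map_zero : f 0 = 0 := by simpa using heq 0 1 (by simp)
  have odd : ∀ t ∈ Iseg, f (-t) = -f t := by
    intro t ht
    have h := add_neg_const 0 zero_mem
    rw [neg_zero, map_zero] at h
    linarith [add_neg_const t ht]
  have doubling : ∀ t ∈ Iseg, f t = 2 * f ((1 + t) / 2) - f 1 := by
    intro t ht
    have h := odd ((1 - t) / 2) ⟨by linarith [(half_mem t ht).2], by linarith [ht.1]⟩
    linarith [sum_mixed t ht, sum_one t ht]
  -- The deviation from the linear map doubles under `x ↦ 2 * x - 1`, so its maximum is zero.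
  obtain ⟨m, hm, hmax⟩ := (isCompact_Icc : IsCompact Iseg).exists_isMaxOn ⟨0, zero_mem⟩
    (f := fun t => |f t - f 1 * t|) (by fun_prop)
  have hmax : ∀ t ∈ Iseg, |f t - f 1 * t| ≤ |f m - f 1 * m| := hmax
  have nonneg_bound : ∀ x ∈ Iseg, 0 ≤ x → 2 * |f x - f 1 * x| ≤ |f m - f 1 * m| := by
    intro x hx hx0
    have hmem : 2 * x - 1 ∈ Iseg := ⟨by linarith, by linarith [hx.2]⟩
    have h := doubling _ hmem
    rw [show (1 + (2 * x - 1)) / 2 = x by ring] at h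
    calc 2 * |f x - f 1 * x| = |2 * (f x - f 1 * x)| := by rw [abs_mul, abs_two]
      _ = |f (2 * x - 1) - f 1 * (2 * x - 1)| := by rw [h]; ring_nf
      _ ≤ _ := hmax _ hmem
  have max_nonpos : |f m - f 1 * m| ≤ 0 := by
    rcases le_total 0 m with h | h
    · linarith [nonneg_bound m hm h]
    · have hb := nonneg_bound (-m) (neg_mem m hm) (neg_nonneg.2 h)
      rw [odd m hm, show -f m - f 1 * -m = -(f m - f 1 * m) by ring, abs_neg] at hb
      linarith
  exact ⟨f 1, fun t ht => sub_eq_zero.1 (abs_nonpos_iff.1 ((hmax t ht).trans max_nonpos))⟩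
end

section
/- Let Γ = {(x,y) : |x| + |y| = 1} \ {(x, x+1) : -1 < x < 0}, and let f : [-1,1] → ℝ be continuous and satisfy f(x + y) = f(x) + f(y) for all (x, y) ∈ Γ. Then there exists c ∈ ℝ such that f(t) = c·t for all t ∈ [-1,1]. -/
open Set

/-- The Cauchy equation is symmetric in its two arguments, so omitting one of two mirror-image
segments from the curve loses nothing. -/
theorem cauchy_on_boundary_of_gamma {f : ℝ → ℝ}
    (heq : ∀ x y : ℝ, |x| + |y| = 1 → ¬(-1 < x ∧ x < 0 ∧ y = x + 1) → f (x + y) = f x + f y)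
    {x y : ℝ} (h : |x| + |y| = 1) : f (x + y) = f x + f y := by
  by_cases hxy : -1 < x ∧ x < 0 ∧ y = x + 1
  · rw [add_comm x y, add_comm (f x)]
    refine heq y x (by rw [add_comm, h]) ?_
    rintro ⟨-, hy, -⟩
    linarith [hxy.1, hxy.2.2]
  · exact heq x y h hxy

/-- A function on `[0, 1]` that is continuous, antisymmetric about `1 / 2` and doubles under
`x ↦ 2 * x` vanishes. -/
theorem eq_zero_of_doubling_of_antisymm {g : ℝ → ℝ} (hg : ContinuousOn g (Icc 0 1))
    (hanti : ∀ x ∈ Icc (0 : ℝ) 1, g (1 - x) = -g x)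
    (hdouble : ∀ x ∈ Icc (0 : ℝ) (1 / 2), g (2 * x) = 2 * g x) :
    ∀ x ∈ Icc (0 : ℝ) 1, g x = 0 := by
  obtain ⟨z, hz, hmax⟩ := isCompact_Icc.exists_isMaxOn (nonempty_Icc.2 zero_le_one) hg.abs
  have hle : ∀ x ∈ Icc (0 : ℝ) 1, |g x| ≤ |g z| := fun x hx => hmax hx
  have hhalf : ∀ w ∈ Icc (0 : ℝ) (1 / 2), |g w| = |g z| → |g z| ≤ 0 := by
    intro w hw hwz
    have h := hle (2 * w) ⟨by linarith [hw.1], by linarith [hw.2]⟩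
    rw [hdouble w hw, abs_mul, abs_two, hwz] at h
    linarith
  have hz0 : |g z| ≤ 0 := by
    rcases le_total z (1 / 2) with h | h
    · exact hhalf z ⟨hz.1, h⟩ rfl
    · exact hhalf (1 - z) ⟨by linarith [hz.2], by linarith⟩ (by rw [hanti z hz, abs_neg])
  exact fun x hx => abs_nonpos_iff.1 ((hle x hx).trans hz0)

/-- A continuous solution of the Cauchy equation restricted to the curve
`Γ = ∂K \\ {(x, x+1) : -1 < x < 0}` is linear. -/
theorem cauchy_on_gamma_linear (f : ℝ → ℝ)
    (hf : ContinuousOn f Iseg)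
    (heq : ∀ x y : ℝ, |x| + |y| = 1 → ¬(-1 < x ∧ x < 0 ∧ y = x + 1) →
      f (x + y) = f x + f y) :
    ∃ c : ℝ, ∀ t ∈ Iseg, f t = c * t := by
  have hadd : ∀ x y : ℝ, |x| + |y| = 1 → f (x + y) = f x + f y :=
    fun x y h => cauchy_on_boundary_of_gamma heq h
  have hpos : ∀ x ∈ Icc (0 : ℝ) 1, f 1 = f x + f (1 - x) := by
    rintro x ⟨h0, h1⟩
    have h := hadd x (1 - x) (by
      rw [abs_of_nonneg h0, abs_of_nonneg (sub_nonneg.2 h1)]; ring)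
    rwa [add_sub_cancel] at h
  have hneg : ∀ x ∈ Icc (0 : ℝ) 1, f (-1) = f (-x) + f (x - 1) := by
    rintro x ⟨h0, h1⟩
    have h := hadd (-x) (x - 1) (by
      rw [abs_neg, abs_of_nonneg h0, abs_of_nonpos (sub_nonpos.2 h1)]; ring)
    rwa [show -x + (x - 1) = -1 by ring] at h
  have hmix : ∀ x ∈ Icc (0 : ℝ) 1, f (2 * x - 1) = f x + f (x - 1) := by
    rintro x ⟨h0, h1⟩
    have h := hadd x (x - 1) (by
      rw [abs_of_nonneg h0, abs_of_nonpos (sub_nonpos.2 h1)]; ring)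
    rwa [show x + (x - 1) = 2 * x - 1 by ring] at h
  have hodd : f (-1) = -f 1 := by
    have h0 := hpos 1 (by norm_num)
    have h1 := hpos (1 / 2) (by norm_num)
    have h2 := hneg (1 / 2) (by norm_num)
    have h3 := hmix (1 / 2) (by norm_num)
    norm_num at h0 h1 h2 h3
    linarith
  have hshift : ∀ y ∈ Icc (0 : ℝ) 1, f (y - 1) = f y - f 1 := by
    rintro y ⟨h0, h1⟩
    have hx : (1 + y) / 2 ∈ Icc (0 : ℝ) 1 := ⟨by linarith, by linarith⟩
    have hx' : (1 - y) / 2 ∈ Icc (0 : ℝ) 1 := ⟨by linarith, by linarith⟩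
    have e1 := hmix _ hx
    have e2 := hmix _ hx'
    have e3 := hpos _ hx
    have e4 := hneg _ hx
    have e5 := hneg y ⟨h0, h1⟩
    rw [show 2 * ((1 + y) / 2) - 1 = y by ring] at e1
    rw [show 2 * ((1 - y) / 2) - 1 = -y by ring,
      show (1 - y) / 2 - 1 = -((1 + y) / 2) by ring] at e2
    rw [show 1 - (1 + y) / 2 = (1 - y) / 2 by ring] at e3
    linarith
  have hzero := eq_zero_of_doubling_of_antisymm (g := fun t => f t - f 1 * t)
    ((hf.mono (Icc_subset_Icc (by norm_num) le_rfl)).sub (by fun_prop))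
    (fun x hx => by
      have h := hpos x hx
      linarith)
    (fun x hx => by
      have hx1 : x ∈ Icc (0 : ℝ) 1 := ⟨hx.1, by linarith [hx.2]⟩
      have h1 := hmix x hx1
      have h2 := hshift x hx1
      have h3 := hshift (2 * x) ⟨by linarith [hx.1], by linarith [hx.2]⟩
      linarith)
  refine ⟨f 1, fun t ht => ?_⟩
  rcases le_total 0 t with h | h
  · exact sub_eq_zero.1 (hzero t ⟨h, ht.2⟩)
  · have ht' : t + 1 ∈ Icc (0 : ℝ) 1 := ⟨by linarith [ht.1], by linarith⟩
    have h1 := hshift (t + 1) ht'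
    have h2 := hzero (t + 1) ht'
    rw [add_sub_cancel_right] at h1
    linarith
end
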